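/- Suppose k = k(n) ≥ 3 and r = r(n) ≥ 3 satisfy (3/128) · r^{k-1}/√k − ln n → −∞ as n → ∞. If p = p(n) ≤ (3/32) · (r^{k-1}/k^{3/2}) · n/C(n,k), then P(H(n,k,p) is r-colorable) → 1 as n → ∞. -/

import Mathlib

open Finset Filter

open scoped Classical

namespace HG

/-- A finset `e` is monochromatic under the coloring `c`. -/
def Monochromatic {V α : Type*} (c : V → α) (e : Finset V) : Prop :=
  ∀ v ∈ e, ∀ w ∈ e, c v = c w

/-- The hypergraph with edge set `E` admits a proper coloring with `r` colors. -/
def RColorable {V : Type*} (r : ℕ) (E : Finset (Finset V)) : Prop :=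
  ∃ c : V → Fin r, ∀ e ∈ E, ¬ Monochromatic c e

/-- The hypergraph with edge set `E` is `r`-choosable: for every assignment of
color lists of size `r` there is a proper coloring from the lists. -/
def RChoosable {V : Type*} (r : ℕ) (E : Finset (Finset V)) : Prop :=
  ∀ L : V → Finset ℕ, (∀ v, (L v).card = r) →
    ∃ c : V → ℕ, (∀ v, c v ∈ L v) ∧ ∀ e ∈ E, ¬ Monochromatic c e

/-- Probability that the binomial random hypergraph `H(n,k,p)` (each of the
`C(n,k)` possible `k`-element edges present independently with probability `p`)
satisfies the property `P` of its edge set. -/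
noncomputable def hyperProb (n k : ℕ) (p : ℝ)
    (P : Finset (Finset (Fin n)) → Prop) : ℝ :=
  ∑ E ∈ ((Finset.univ : Finset (Fin n)).powersetCard k).powerset,
    if P E then
      p ^ E.card *
        (1 - p) ^ (((Finset.univ : Finset (Fin n)).powersetCard k).card - E.card)
    else 0

/-- Maximum vertex degree of the hypergraph with edge set `E`. -/
def maxDegree {V : Type*} [DecidableEq V] (E : Finset (Finset V)) : ℕ :=
  (E.biUnion id).sup fun v => (E.filter fun e => v ∈ e).card

/-- Three distinct edges forming a 3-cycle (triangle). -/
def IsTriangle {V : Type*} [DecidableEq V] (e f h : Finset V) : Prop :=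
  e ≠ f ∧ e ≠ h ∧ f ≠ h ∧ ((e ∩ f) \ h).Nonempty ∧ ((e ∩ h) \ f).Nonempty ∧
    ((f ∩ h) \ e).Nonempty

/-- A hypergraph is 2-simple if any two distinct edges share at most 2 vertices. -/
def TwoSimple {V : Type*} [DecidableEq V] (E : Finset (Finset V)) : Prop :=
  ∀ e ∈ E, ∀ f ∈ E, e ≠ f → (e ∩ f).card ≤ 2

/-- The number of 3-cycles of the hypergraph `E` containing the edge `e`. -/
noncomputable def triCount {V : Type*} [DecidableEq V]
    (E : Finset (Finset V)) (e : Finset V) : ℕ :=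
  ((E.powersetCard 2).filter fun s =>
    ∃ f ∈ s, ∃ h ∈ s, f ≠ h ∧ IsTriangle e f h).card

/-- The function `φ(k) = 4⌊√(ln k / ln (2 ln k))⌋⁻¹`. -/
noncomputable def phi (k : ℕ) : ℝ :=
  4 * ((⌊Real.sqrt (Real.log k / Real.log (2 * Real.log k))⌋₊ : ℝ))⁻¹

end HG

namespace HG

/-- Expectation of `f` over a random subset of `Q` containing each element independently with
probability `p`. -/
noncomputable def expect {α : Type*} (p : ℝ) (Q : Finset α) (f : Finset α → ℝ) : ℝ :=
  ∑ A ∈ Q.powerset, p ^ A.card * (1 - p) ^ (Q.card - A.card) * f A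

/-- The indicator of a proposition. -/
noncomputable def ind (P : Prop) : ℝ := if P then 1 else 0

lemma ind_nonneg (P : Prop) : 0 ≤ ind P := by unfold ind; split_ifs <;> norm_num

lemma ind_le_one (P : Prop) : ind P ≤ 1 := by unfold ind; split_ifs <;> norm_num

lemma ind_mono {P Q : Prop} (h : P → Q) : ind P ≤ ind Q := by
  unfold ind
  split_ifs with hP hQ
  · exact le_rfl
  · exact absurd (h hP) hQ
  · norm_num
  · exact le_rfl

lemma ind_of_true {P : Prop} (h : P) : ind P = 1 := if_pos h

lemma ind_of_false {P : Prop} (h : ¬ P) : ind P = 0 := if_neg h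

section Expect

variable {α : Type*} {p : ℝ}

lemma expect_mono (hp0 : 0 ≤ p) (hp1 : p ≤ 1) {Q : Finset α} {f g : Finset α → ℝ}
    (h : ∀ A ⊆ Q, f A ≤ g A) : expect p Q f ≤ expect p Q g := by
  refine Finset.sum_le_sum fun A hA => ?_
  have : (0 : ℝ) ≤ 1 - p := by linarith
  exact mul_le_mul_of_nonneg_left (h A (Finset.mem_powerset.1 hA)) (by positivity)

lemma expect_congr {Q : Finset α} {f g : Finset α → ℝ}
    (h : ∀ A ⊆ Q, f A = g A) : expect p Q f = expect p Q g :=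
  Finset.sum_congr rfl fun A hA => by rw [h A (Finset.mem_powerset.1 hA)]

lemma expect_insert [DecidableEq α] {Q : Finset α} {a : α} (ha : a ∉ Q) (f : Finset α → ℝ) :
    expect p (insert a Q) f =
      p * expect p Q (fun A => f (insert a A)) + (1 - p) * expect p Q f := by
  unfold expect
  rw [Finset.sum_powerset_insert ha, add_comm, Finset.mul_sum, Finset.mul_sum]
  congr 1
  · refine Finset.sum_congr rfl fun A hA => ?_
    have hA' := Finset.mem_powerset.1 hA
    rw [Finset.card_insert_of_notMem ha, Finset.card_insert_of_notMem fun h => ha (hA' h),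
      Nat.add_sub_add_right]
    ring
  · refine Finset.sum_congr rfl fun A hA => ?_
    have hA' := Finset.card_le_card (Finset.mem_powerset.1 hA)
    rw [Finset.card_insert_of_notMem ha, Nat.sub_add_comm hA']
    ring

lemma expect_empty (f : Finset α → ℝ) : expect p ∅ f = f ∅ := by
  simp [expect]

lemma expect_union [DecidableEq α] {Q R : Finset α} (h : Disjoint Q R) (f : Finset α → ℝ) :
    expect p (Q ∪ R) f = expect p Q fun A => expect p R fun B => f (A ∪ B) := by
  induction Q using Finset.induction_on generalizing f with
  | empty => simp [expect_empty]
  | insert a Q ha ih =>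
    rw [Finset.disjoint_insert_left] at h
    rw [Finset.insert_union, expect_insert (by simp [ha, h.1]), expect_insert ha, ih h.2, ih h.2]
    simp only [Finset.insert_union]

lemma expect_add (Q : Finset α) (f g : Finset α → ℝ) :
    expect p Q (fun A => f A + g A) = expect p Q f + expect p Q g := by
  simp [expect, mul_add, Finset.sum_add_distrib]

lemma expect_sum {ι : Type*} (s : Finset ι) (Q : Finset α) (f : ι → Finset α → ℝ) :
    expect p Q (fun A => ∑ i ∈ s, f i A) = ∑ i ∈ s, expect p Q (f i) := by
  simp only [expect, Finset.mul_sum]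
  exact Finset.sum_comm

lemma expect_const_mul (Q : Finset α) (c : ℝ) (f : Finset α → ℝ) :
    expect p Q (fun A => c * f A) = c * expect p Q f := by
  simp only [expect, Finset.mul_sum]
  exact Finset.sum_congr rfl fun _ _ => by ring

lemma expect_prod (Q : Finset α) (z : α → ℝ) :
    expect p Q (fun A => ∏ e ∈ A, z e) = ∏ e ∈ Q, (1 + p * (z e - 1)) := by
  induction Q using Finset.induction_on with
  | empty => simp [expect_empty]
  | insert a Q ha ih =>
    have : expect p Q (fun A => ∏ e ∈ insert a A, z e)
        = expect p Q (fun A => z a * ∏ e ∈ A, z e) :=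
      expect_congr fun A hA => Finset.prod_insert fun h => ha (hA h)
    rw [expect_insert ha, Finset.prod_insert ha, this, expect_const_mul, ih]
    ring

lemma expect_const (Q : Finset α) (c : ℝ) : expect p Q (fun _ => c) = c := by
  have := expect_prod (p := p) Q (fun _ => 1)
  have h := expect_const_mul (p := p) Q c (fun A => ∏ e ∈ A, 1)
  simp only [Finset.prod_const_one, mul_one] at h this
  rw [h, this]
  simp

lemma expect_indicator_le_one (hp0 : 0 ≤ p) (hp1 : p ≤ 1) (Q : Finset α)
    (P : Finset α → Prop) : expect p Q (fun A => ind (P A)) ≤ 1 := by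
  refine (expect_mono hp0 hp1 (g := fun _ => 1) fun A _ => ind_le_one _).trans_eq
    (expect_const Q 1)

lemma expect_subset {Q G : Finset α} (hG : G ⊆ Q) :
    expect p Q (fun A => ind (G ⊆ A)) = p ^ G.card := by
  obtain ⟨R, hR, rfl⟩ : ∃ R, Disjoint G R ∧ Q = G ∪ R :=
    ⟨Q \ G, Finset.disjoint_sdiff, by simp [hG]⟩
  rw [expect_union hR]
  have h1 : expect p G (fun A => expect p R fun B => ind (G ⊆ A ∪ B)) =
      expect p G (fun A => ind (A = G)) := by
    refine expect_congr fun A hA => ?_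
    rw [← expect_const (p := p) R (ind (A = G))]
    refine expect_congr fun B hB => ?_
    congr 1
    refine propext ⟨fun h => Finset.Subset.antisymm hA fun x hx => ?_, fun h => h ▸ by simp⟩
    rcases Finset.mem_union.1 (h hx) with h | h
    · exact h
    · exact absurd (hB h) (Finset.disjoint_left.1 hR hx)
  rw [h1]
  simp [expect, ind]

/-- The union bound. -/
lemma expect_le_sum_pow {ι : Type*} (hp0 : 0 ≤ p) (hp1 : p ≤ 1) {Q : Finset α}
    (P : Finset α → Prop) (s : Finset ι) (G : ι → Finset α) (hG : ∀ i ∈ s, G i ⊆ Q)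
    (h : ∀ A ⊆ Q, P A → ∃ i ∈ s, G i ⊆ A) :
    expect p Q (fun A => ind (P A)) ≤ ∑ i ∈ s, p ^ (G i).card := by
  calc _ ≤ expect p Q (fun A => ∑ i ∈ s, ind (G i ⊆ A)) := by
        refine expect_mono hp0 hp1 fun A hA => ?_
        have h0 : ∀ i ∈ s, (0 : ℝ) ≤ ind (G i ⊆ A) := fun i _ => ind_nonneg _
        by_cases hP : P A
        · obtain ⟨i, hi, hiA⟩ := h A hA hP
          rw [ind_of_true hP, ← ind_of_true hiA]
          exact Finset.single_le_sum h0 hi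
        · rw [ind_of_false hP]
          exact Finset.sum_nonneg h0
    _ = _ := by
        rw [expect_sum]
        exact Finset.sum_congr rfl fun i hi => expect_subset (hG i hi)

end Expect

section Hall

variable {α ω : Type*}

lemma exists_injOn_of_hall [Nonempty ω] (O : α → Finset ω) (E : Finset α)
    (h : ∀ A ⊆ E, A.card ≤ (A.biUnion O).card) :
    ∃ φ : α → ω, Set.InjOn φ E ∧ ∀ f ∈ E, φ f ∈ O f := by
  have key := (Finset.all_card_le_biUnion_card_iff_exists_injective
    (fun f : {f // f ∈ E} => O f.1)).1 fun s => by
      have := h (s.map (Function.Embedding.subtype _)) fun x hx => by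
        obtain ⟨y, -, rfl⟩ := Finset.mem_map.1 hx
        exact y.2
      rw [Finset.card_map] at this
      refine this.trans (Finset.card_le_card fun x hx => ?_)
      obtain ⟨y, hy, hx⟩ := Finset.mem_biUnion.1 hx
      obtain ⟨z, hz, rfl⟩ := Finset.mem_map.1 hy
      exact Finset.mem_biUnion.2 ⟨z, hz, hx⟩
  obtain ⟨g, hg, hgO⟩ := key
  refine ⟨fun f => if hf : f ∈ E then g ⟨f, hf⟩ else Classical.arbitrary ω, ?_, ?_⟩
  · intro x hx y hy hxy
    have hx : x ∈ E := hx
    have hy : y ∈ E := hy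
    simp only [hx, hy, dif_pos] at hxy
    exact congrArg Subtype.val (hg hxy)
  · intro f hf
    simp only [hf, dif_pos]
    exact hgO ⟨f, hf⟩

/-- A minimal violator of Hall's condition has a vertex whose removal leaves a perfect matching. -/
lemma exists_hall_obstruction [Nonempty ω] (O : α → Finset ω) (E : Finset α)
    (h : ¬ ∃ φ : α → ω, Set.InjOn φ E ∧ ∀ f ∈ E, φ f ∈ O f) :
    ∃ A ⊆ E, ∃ f₀ ∈ A, ∃ mu : ω → α,
      (∀ o ∈ A.biUnion O, mu o ∈ A ∧ mu o ≠ f₀ ∧ o ∈ O (mu o)) ∧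
      Set.InjOn mu (A.biUnion O) := by
  have hviol : ∃ A, A ⊆ E ∧ (A.biUnion O).card < A.card := by
    by_contra! hc
    exact h (exists_injOn_of_hall O E hc)
  obtain ⟨A, ⟨hAE, hA⟩, hmin⟩ := WellFounded.has_min
    (measure (Finset.card : Finset α → ℕ)).wf
    {A | A ⊆ E ∧ (A.biUnion O).card < A.card} hviol
  have hne : A.Nonempty := Finset.card_pos.1 (by omega)
  obtain ⟨f₀, hf₀⟩ := hne
  obtain ⟨φ, hφ, hφO⟩ := exists_injOn_of_hall O (A.erase f₀) fun B hB => by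
    by_contra! hc
    refine hmin B ⟨(hB.trans (Finset.erase_subset _ _)).trans hAE, hc⟩ ?_
    exact Finset.card_lt_card (Finset.ssubset_of_subset_of_ssubset hB
      (Finset.erase_ssubset hf₀))
  have himg : (A.erase f₀).image φ = A.biUnion O := by
    refine Finset.eq_of_subset_of_card_le ?_ ?_
    · intro o ho
      obtain ⟨f, hf, rfl⟩ := Finset.mem_image.1 ho
      exact Finset.mem_biUnion.2 ⟨f, Finset.mem_of_mem_erase hf, hφO f hf⟩
    · rw [Finset.card_image_of_injOn hφ, Finset.card_erase_of_mem hf₀]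
      omega
  have hinv : ∀ o, ∃ f, o ∈ A.biUnion O → f ∈ A.erase f₀ ∧ φ f = o := fun o => by
    by_cases ho : o ∈ A.biUnion O
    · rw [← himg] at ho
      obtain ⟨f, hf, hfo⟩ := Finset.mem_image.1 ho
      exact ⟨f, fun _ => ⟨hf, hfo⟩⟩
    · exact ⟨f₀, fun h => absurd h ho⟩
  choose mu hmu using hinv
  refine ⟨A, hAE, f₀, hf₀, mu, fun o ho => ?_, fun x hx y hy hxy => ?_⟩
  · obtain ⟨h1, h2⟩ := hmu o ho
    refine ⟨Finset.mem_of_mem_erase h1, Finset.ne_of_mem_erase h1, ?_⟩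
    have := hφO _ h1
    rwa [h2] at this
  · rw [← (hmu x hx).2, ← (hmu y hy).2, hxy]

end Hall

section Paths

variable {α ω : Type*}

/-- A walk `o, g₁, o₁, g₂, o₂, …` alternating between owners and edges incident with them. -/
def IsPath (O : α → Finset ω) (T : Finset α) : ω → List (α × ω) → Prop
  | _, [] => True
  | o, (g, o') :: q => g ∈ T ∧ o ∈ O g ∧ o' ∈ O g ∧ IsPath O T o' q

/-- The last owner of a walk. -/
def pathEnd : ω → List (α × ω) → ω
  | o, [] => o
  | _, (_, o') :: q => pathEnd o' q

lemma isPath_append (O : α → Finset ω) (T : Finset α) (o : ω) (q : List (α × ω)) (g : α) (o' : ω)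
    (h : IsPath O T o q) (hg : g ∈ T) (h1 : pathEnd o q ∈ O g) (h2 : o' ∈ O g) :
    IsPath O T o (q ++ [(g, o')]) ∧ pathEnd o (q ++ [(g, o')]) = o' := by
  induction q generalizing o with
  | nil => exact ⟨⟨hg, h1, h2, trivial⟩, rfl⟩
  | cons x q ih =>
    obtain ⟨a, b, c, d⟩ := h
    obtain ⟨e, f⟩ := ih x.2 d h1
    exact ⟨⟨a, b, c, e⟩, f⟩

lemma pathEnd_mem (o : ω) (q : List (α × ω)) : pathEnd o q ∈ o :: q.map Prod.snd := by
  induction q generalizing o with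
  | nil => simp [pathEnd]
  | cons x q ih => exact List.mem_cons_of_mem _ (ih x.2)

/-- All walks of a given length from a given owner. -/
noncomputable def paths (O : α → Finset ω) (T : Finset α) : ℕ → ω → Finset (List (α × ω))
  | 0, _ => {[]}
  | m + 1, o => (T.filter fun g => o ∈ O g).biUnion fun g => (O g).biUnion fun o' =>
      (paths O T m o').image fun q => (g, o') :: q

lemma mem_paths {O : α → Finset ω} {T : Finset α} {o : ω} {q : List (α × ω)}
    (h : IsPath O T o q) : q ∈ paths O T q.length o := by
  induction q generalizing o with
  | nil => simp [paths]
  | cons x q ih =>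
    obtain ⟨a, b, c, d⟩ := h
    simp only [paths, List.length_cons, Finset.mem_biUnion, Finset.mem_filter, Finset.mem_image]
    exact ⟨x.1, ⟨a, b⟩, x.2, c, q, ih d, rfl⟩

lemma length_of_mem_paths {O : α → Finset ω} {T : Finset α} {m : ℕ} {o : ω} {q : List (α × ω)}
    (h : q ∈ paths O T m o) : q.length = m ∧ IsPath O T o q := by
  induction m generalizing o q with
  | zero => simp [paths] at h; simp [h, IsPath]
  | succ m ih =>
    simp only [paths, Finset.mem_biUnion, Finset.mem_filter, Finset.mem_image] at h
    obtain ⟨g, ⟨a, b⟩, o', c, q', d, rfl⟩ := h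
    exact ⟨by simp [(ih d).1], a, b, c, (ih d).2⟩

lemma card_paths_le {O : α → Finset ω} {T : Finset α} {W : Finset ω} (hOW : ∀ f ∈ T, O f ⊆ W)
    {p l : ℝ} {k : ℕ} (hp : 0 ≤ p) (hk : ∀ f ∈ T, (O f).card ≤ k)
    (h1 : ∀ o ∈ W, p * k * (T.filter fun f => o ∈ O f).card ≤ l) (m : ℕ) (o : ω) (ho : o ∈ W) :
    p ^ m * (paths O T m o).card ≤ l ^ m := by
  have hl : 0 ≤ l := le_trans (by positivity) (h1 o ho)
  induction m generalizing o with
  | zero => simp [paths]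
  | succ m ih =>
    have hc : ((paths O T (m + 1) o).card : ℝ) ≤
        ∑ g ∈ T.filter (fun g => o ∈ O g), ∑ o' ∈ O g, ((paths O T m o').card : ℝ) := by
      norm_cast
      refine Finset.card_biUnion_le.trans (Finset.sum_le_sum fun g _ => ?_)
      refine Finset.card_biUnion_le.trans (Finset.sum_le_sum fun o' _ => ?_)
      exact Finset.card_image_le
    calc p ^ (m + 1) * ((paths O T (m + 1) o).card : ℝ)
        ≤ p ^ (m + 1) * ∑ g ∈ T.filter (fun g => o ∈ O g), ∑ o' ∈ O g,
            ((paths O T m o').card : ℝ) := by gcongr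
      _ = p * ∑ g ∈ T.filter (fun g => o ∈ O g), ∑ o' ∈ O g,
            p ^ m * ((paths O T m o').card : ℝ) := by
          simp only [Finset.mul_sum]
          exact Finset.sum_congr rfl fun _ _ => Finset.sum_congr rfl fun _ _ => by ring
      _ ≤ p * ∑ g ∈ T.filter (fun g => o ∈ O g), k * l ^ m := by
          gcongr with g hg
          have hgT := (Finset.mem_filter.1 hg).1
          calc _ ≤ ∑ o' ∈ O g, l ^ m := Finset.sum_le_sum fun o' ho' => ih o' (hOW g hgT ho')
            _ = (O g).card * l ^ m := by simp
            _ ≤ _ := by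
              have := hk g hgT
              gcongr
      _ = (p * k * (T.filter fun f => o ∈ O f).card) * l ^ m := by simp; ring
      _ ≤ l * l ^ m := by gcongr; exact h1 o ho
      _ = l ^ (m + 1) := by ring

end Paths

section Witness

variable {α ω : Type*}

lemma exists_closed_walk {O : α → Finset ω} {T A : Finset α} (hA : A ⊆ T) {f₀ : α}
    (hf₀ : f₀ ∈ A) (mu : ω → α)
    (hmu : ∀ o ∈ A.biUnion O, mu o ∈ A ∧ mu o ≠ f₀ ∧ o ∈ O (mu o)) (d : ℕ) :
    ∀ (o : ω) (q : List (α × ω)) (h t : α), (A.biUnion O).card ≤ q.length + d →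
      (o :: q.map Prod.snd).Nodup → (∀ x ∈ o :: q.map Prod.snd, x ∈ A.biUnion O) →
      (h :: t :: q.map Prod.fst).Perm (f₀ :: (o :: q.map Prod.snd).map mu) →
      IsPath O T o q → o ∈ O h → pathEnd o q ∈ O t →
    ∃ (o : ω) (q : List (α × ω)) (h t : α),
      (o :: q.map Prod.snd).Nodup ∧ (∀ x ∈ o :: q.map Prod.snd, x ∈ A.biUnion O) ∧
      (h :: t :: q.map Prod.fst).Perm (f₀ :: (o :: q.map Prod.snd).map mu) ∧
      IsPath O T o q ∧ o ∈ O h ∧ pathEnd o q ∈ O t ∧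
      O h ⊆ (o :: q.map Prod.snd).toFinset ∧ O t ⊆ (o :: q.map Prod.snd).toFinset := by
  induction d with
  | zero =>
    intro o q h t hc hnd hW
    exfalso
    have := Finset.card_le_card (s := (o :: q.map Prod.snd).toFinset) (t := A.biUnion O)
      fun x hx => hW x (List.mem_toFinset.1 hx)
    rw [List.toFinset_card_of_nodup hnd] at this
    simp at this
    omega
  | succ d ih =>
    intro o q h t hc hnd hW hperm hpath hoh hpt
    have hitem : ∀ x ∈ h :: t :: q.map Prod.fst, x ∈ A := by
      intro x hx
      rcases List.mem_cons.1 (hperm.mem_iff.1 hx) with rfl | hx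
      · exact hf₀
      · obtain ⟨y, hy, rfl⟩ := List.mem_map.1 hx
        exact (hmu y (hW y hy)).1
    have hhA : h ∈ A := hitem h (by simp)
    have htA : t ∈ A := hitem t (by simp)
    by_cases h1 : O h ⊆ (o :: q.map Prod.snd).toFinset
    · by_cases h2 : O t ⊆ (o :: q.map Prod.snd).toFinset
      · exact ⟨o, q, h, t, hnd, hW, hperm, hpath, hoh, hpt, h1, h2⟩
      · obtain ⟨o', ho', hno⟩ := Finset.not_subset.1 h2
        rw [List.mem_toFinset] at hno
        have hoW : o' ∈ A.biUnion O := Finset.mem_biUnion.2 ⟨t, htA, ho'⟩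
        obtain ⟨hp1, hp2⟩ := isPath_append O T o q t o' hpath (hA htA) hpt ho'
        refine ih o (q ++ [(t, o')]) h (mu o') (by simp; omega) ?_ ?_ ?_ hp1 hoh ?_
        · rw [List.map_append, ← List.cons_append]
          refine List.Nodup.append hnd (by simp) ?_
          simpa [List.disjoint_singleton] using hno
        · intro x hx
          rw [List.map_append, ← List.cons_append, List.mem_append] at hx
          rcases hx with hx | hx
          · exact hW x hx
          · simp at hx; exact hx ▸ hoW
        · have e2 : (f₀ :: (o :: (q ++ [(t, o')]).map Prod.snd).map mu) =
              (f₀ :: (o :: q.map Prod.snd).map mu) ++ [mu o'] := by simp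
          have e1 : (h :: mu o' :: (q ++ [(t, o')]).map Prod.fst).Perm
              ((h :: t :: q.map Prod.fst) ++ [mu o']) := by
            rw [List.perm_iff_count]
            intro a
            simp [List.count_cons, List.count_append]
            omega
          rw [e2]
          exact e1.trans (hperm.append_right _)
        · rw [hp2]
          exact (hmu o' hoW).2.2
    · obtain ⟨o', ho', hno⟩ := Finset.not_subset.1 h1
      rw [List.mem_toFinset] at hno
      have hoW : o' ∈ A.biUnion O := Finset.mem_biUnion.2 ⟨h, hhA, ho'⟩
      refine ih o' ((h, o) :: q) (mu o') t (by simp; omega) ?_ ?_ ?_ ?_ (hmu o' hoW).2.2 hpt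
      · exact List.nodup_cons.2 ⟨hno, hnd⟩
      · intro x hx
        rcases List.mem_cons.1 hx with rfl | hx
        · exact hoW
        · exact hW x hx
      · rw [List.perm_iff_count] at hperm ⊢
        intro a
        have := hperm a
        simp [List.count_cons] at this ⊢
        omega
      · exact ⟨hA hhA, ho', hoh, hpath⟩

lemma exists_walk_of_not_sdr [Nonempty ω] {O : α → Finset ω} {T E : Finset α} (hE : E ⊆ T)
    (hO : ∀ f ∈ T, (O f).Nonempty)
    (h : ¬ ∃ φ : α → ω, Set.InjOn φ E ∧ ∀ f ∈ E, φ f ∈ O f) :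
    ∃ (o : ω) (q : List (α × ω)) (h t : α),
      (o :: q.map Prod.snd).Nodup ∧ (∀ x ∈ o :: q.map Prod.snd, ∃ f ∈ E, x ∈ O f) ∧
      (h :: t :: q.map Prod.fst).Nodup ∧ (∀ f ∈ h :: t :: q.map Prod.fst, f ∈ E) ∧
      IsPath O T o q ∧ o ∈ O h ∧ pathEnd o q ∈ O t ∧
      O h ⊆ (o :: q.map Prod.snd).toFinset ∧ O t ⊆ (o :: q.map Prod.snd).toFinset := by
  obtain ⟨A, hAE, f₀, hf₀, mu, hmu, hinj⟩ := exists_hall_obstruction O E h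
  obtain ⟨o, ho⟩ := hO f₀ (hE (hAE hf₀))
  have hoW : o ∈ A.biUnion O := Finset.mem_biUnion.2 ⟨f₀, hf₀, ho⟩
  obtain ⟨o, q, h, t, a1, a2, a3, a4, a5, a6, a7, a8⟩ :=
    exists_closed_walk (hAE.trans hE) hf₀ mu hmu (A.biUnion O).card o [] (mu o) f₀ (by simp)
      (by simp) (by simpa using hoW) (List.Perm.swap _ _ _) trivial (hmu o hoW).2.2 ho
  refine ⟨o, q, h, t, a1, fun x hx => ?_, ?_, fun f hf => ?_, a4, a5, a6, a7, a8⟩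
  · obtain ⟨f, hf, hx⟩ := Finset.mem_biUnion.1 (a2 x hx)
    exact ⟨f, hAE hf, hx⟩
  · rw [a3.nodup_iff, List.nodup_cons]
    refine ⟨fun hm => ?_, a1.map_on fun x hx y hy => hinj (a2 x hx) (a2 y hy)⟩
    obtain ⟨y, hy, hyf⟩ := List.mem_map.1 hm
    exact (hmu y (a2 y hy)).2.1 hyf
  · rcases List.mem_cons.1 (a3.mem_iff.1 hf) with rfl | hx
    · exact hAE hf₀
    · obtain ⟨y, hy, rfl⟩ := List.mem_map.1 hx
      exact hAE (hmu y (a2 y hy)).1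

lemma fst_mem_of_isPath {O : α → Finset ω} {T : Finset α} {o : ω} {q : List (α × ω)}
    (h : IsPath O T o q) : ∀ y ∈ q, y.1 ∈ T := by
  induction q generalizing o with
  | nil => simp
  | cons x q ih =>
    obtain ⟨a, -, -, d⟩ := h
    intro y hy
    rcases List.mem_cons.1 hy with rfl | hy
    · exact a
    · exact ih d y hy

lemma sum_sq_mul_pow_le (M : ℕ) :
    ∑ m ∈ Finset.range M, ((m : ℝ) + 1) ^ 2 * (3 / 4) ^ m ≤ 112 := by
  have : ∑ m ∈ Finset.range M, ((m : ℝ) + 1) ^ 2 * (3 / 4) ^ m =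
      112 - (4 * (M : ℝ) ^ 2 + 32 * M + 112) * (3 / 4) ^ M := by
    induction M with
    | zero => simp
    | succ M ih => rw [Finset.sum_range_succ, ih]; push_cast; ring
  rw [this]
  have : (0 : ℝ) ≤ (4 * (M : ℝ) ^ 2 + 32 * M + 112) * (3 / 4) ^ M := by positivity
  linarith

lemma expect_not_sdr_le [Nonempty ω] {p : ℝ} (hp0 : 0 ≤ p) (hp1 : p ≤ 1)
    {O : α → Finset ω} {Q T : Finset α} (hTQ : T ⊆ Q) {W : Finset ω} {k : ℕ} {κ : ℝ}
    (hκ : 0 ≤ κ) (hO : ∀ f ∈ T, (O f).Nonempty) (hOW : ∀ f ∈ T, O f ⊆ W)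
    (hk : ∀ f ∈ T, (O f).card ≤ k)
    (h1 : ∀ o ∈ W, p * k * (T.filter fun f => o ∈ O f).card ≤ 3 / 4)
    (h2 : ∀ R ⊆ W, ∀ o ∈ R, p * (T.filter fun f => o ∈ O f ∧ O f ⊆ R).card ≤ R.card * κ) :
    expect p Q (fun E => ind (¬ ∃ φ : α → ω, Set.InjOn φ {f | f ∈ E ∧ f ∈ T} ∧
      ∀ f ∈ E, f ∈ T → φ f ∈ O f)) ≤ 112 * W.card * κ ^ 2 := by
  set cl : ω → List (α × ω) → ω → Finset α := fun o q x =>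
    T.filter fun f => x ∈ O f ∧ O f ⊆ (o :: q.map Prod.snd).toFinset with hcl
  set S : Finset ((_ : ℕ) × (_ : ω) × (_ : List (α × ω)) × (_ : α) × α) :=
    (Finset.range W.card).sigma fun m => W.sigma fun o =>
      ((paths O T m o).filter fun q => (o :: q.map Prod.snd).Nodup ∧
        ∀ x ∈ o :: q.map Prod.snd, x ∈ W).sigma fun q =>
        (cl o q o).sigma fun _ => cl o q (pathEnd o q) with hS
  set items : ((_ : ℕ) × (_ : ω) × (_ : List (α × ω)) × (_ : α) × α) → List α :=
    fun i => i.2.2.2.1 :: i.2.2.2.2 :: i.2.2.1.map Prod.fst with hitems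
  have hmemS : ∀ i, i ∈ S ↔ i.1 < W.card ∧ i.2.1 ∈ W ∧ (i.2.2.1 ∈ paths O T i.1 i.2.1 ∧
      (i.2.1 :: i.2.2.1.map Prod.snd).Nodup ∧ ∀ x ∈ i.2.1 :: i.2.2.1.map Prod.snd, x ∈ W) ∧
      i.2.2.2.1 ∈ cl i.2.1 i.2.2.1 i.2.1 ∧
      i.2.2.2.2 ∈ cl i.2.1 i.2.2.1 (pathEnd i.2.1 i.2.2.1) := fun i => by
    simp only [hS, Finset.mem_sigma, Finset.mem_range, Finset.mem_filter]
  have hmain := expect_le_sum_pow hp0 hp1 (Q := Q)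
    (fun E => ¬ ∃ φ : α → ω, Set.InjOn φ {f | f ∈ E ∧ f ∈ T} ∧ ∀ f ∈ E, f ∈ T → φ f ∈ O f)
    (S.filter fun i => (items i).Nodup) (fun i => (items i).toFinset ∩ T) (fun i _ =>
      Finset.inter_subset_right.trans hTQ) ?_
  · refine hmain.trans ?_
    have hstep : ∑ i ∈ S.filter (fun i => (items i).Nodup),
        p ^ ((items i).toFinset ∩ T).card ≤ ∑ i ∈ S, p ^ (i.1 + 2) := by
      refine (Finset.sum_le_sum fun i hi => ?_).trans
        (Finset.sum_le_sum_of_subset_of_nonneg (Finset.filter_subset _ _)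
          fun i _ _ => by positivity)
      obtain ⟨hiS, hnd⟩ := Finset.mem_filter.1 hi
      obtain ⟨b1, b2, ⟨b3, b4, b5⟩, b6, b7⟩ := (hmemS i).1 hiS
      obtain ⟨hlen, hpath⟩ := length_of_mem_paths b3
      have hsub : (items i).toFinset ⊆ T := by
        intro x hx
        rw [List.mem_toFinset] at hx
        simp only [hitems, List.mem_cons, List.mem_map] at hx
        rcases hx with rfl | rfl | ⟨y, hy, rfl⟩
        · exact (Finset.mem_filter.1 b6).1
        · exact (Finset.mem_filter.1 b7).1
        · exact fst_mem_of_isPath hpath y hy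
      rw [Finset.inter_eq_left.2 hsub, List.toFinset_card_of_nodup hnd]
      simp [hitems, hlen]
    refine hstep.trans ?_
    have hclb : ∀ m o, ∀ q ∈ (paths O T m o).filter (fun q => (o :: q.map Prod.snd).Nodup ∧
        ∀ x ∈ o :: q.map Prod.snd, x ∈ W), ∀ x ∈ o :: q.map Prod.snd,
        p * (cl o q x).card ≤ (m + 1) * κ := by
      intro m o q hq x hx
      obtain ⟨hq, hnd, hW⟩ := Finset.mem_filter.1 hq
      have := h2 (o :: q.map Prod.snd).toFinset (fun y hy => hW y (List.mem_toFinset.1 hy)) x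
        (List.mem_toFinset.2 hx)
      rw [List.toFinset_card_of_nodup hnd, List.length_cons, List.length_map,
        (length_of_mem_paths hq).1] at this
      exact_mod_cast this
    calc ∑ i ∈ S, p ^ (i.1 + 2)
        = ∑ m ∈ Finset.range W.card, ∑ o ∈ W, ∑ q ∈ (paths O T m o).filter (fun q =>
            (o :: q.map Prod.snd).Nodup ∧ ∀ x ∈ o :: q.map Prod.snd, x ∈ W),
            p ^ m * ((p * (cl o q o).card) * (p * (cl o q (pathEnd o q)).card)) := by
          rw [hS, Finset.sum_sigma]
          refine Finset.sum_congr rfl fun m _ => ?_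
          rw [Finset.sum_sigma]
          refine Finset.sum_congr rfl fun o _ => ?_
          rw [Finset.sum_sigma]
          refine Finset.sum_congr rfl fun q _ => ?_
          rw [Finset.sum_sigma]
          simp
          ring
      _ ≤ ∑ m ∈ Finset.range W.card, ∑ o ∈ W, ∑ q ∈ (paths O T m o).filter (fun q =>
            (o :: q.map Prod.snd).Nodup ∧ ∀ x ∈ o :: q.map Prod.snd, x ∈ W),
            p ^ m * (((m + 1) * κ) * ((m + 1) * κ)) := by
          refine Finset.sum_le_sum fun m _ => Finset.sum_le_sum fun o _ =>
            Finset.sum_le_sum fun q hq => ?_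
          have i1 := hclb m o q hq o (by simp)
          have i2 := hclb m o q hq _ (pathEnd_mem o q)
          exact mul_le_mul_of_nonneg_left
            (mul_le_mul i1 i2 (by positivity) (by positivity)) (by positivity)
      _ ≤ ∑ m ∈ Finset.range W.card, ∑ o ∈ W, (3 / 4 : ℝ) ^ m *
            (((m + 1) * κ) * ((m + 1) * κ)) := by
          refine Finset.sum_le_sum fun m _ => Finset.sum_le_sum fun o ho => ?_
          rw [Finset.sum_const, nsmul_eq_mul]
          have hle := card_paths_le hOW hp0 hk h1 m o ho
          calc _ ≤ ((paths O T m o).card : ℝ) * (p ^ m * (((m + 1) * κ) * ((m + 1) * κ))) := by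
                gcongr
                exact Finset.filter_subset _ _
            _ = (p ^ m * (paths O T m o).card) * (((m + 1) * κ) * ((m + 1) * κ)) := by ring
            _ ≤ _ := by gcongr
      _ = W.card * κ ^ 2 * ∑ m ∈ Finset.range W.card, ((m : ℝ) + 1) ^ 2 * (3 / 4) ^ m := by
          rw [Finset.mul_sum]
          refine Finset.sum_congr rfl fun m _ => ?_
          rw [Finset.sum_const, nsmul_eq_mul]
          ring
      _ ≤ W.card * κ ^ 2 * 112 := by
          gcongr
          exact sum_sq_mul_pow_le _
      _ = _ := by ring
  · intro E hE hne
    obtain ⟨o, q, h, t, a1, a2, a3, a4, a5, a6, a7, a8, a9⟩ :=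
      exists_walk_of_not_sdr (E := E ∩ T) Finset.inter_subset_right hO
        (by simpa [Finset.coe_inter, Set.inter_def, and_imp] using hne)
    have hRW : ∀ x ∈ o :: q.map Prod.snd, x ∈ W := fun x hx => by
      obtain ⟨f, hf, hx⟩ := a2 x hx
      exact hOW f (Finset.mem_inter.1 hf).2 hx
    refine ⟨⟨q.length, o, q, h, t⟩, Finset.mem_filter.2 ⟨(hmemS _).2 ⟨?_, hRW o (by simp),
      ⟨mem_paths a5, a1, hRW⟩, ?_, ?_⟩, a3⟩, ?_⟩
    · have := Finset.card_le_card (s := (o :: q.map Prod.snd).toFinset) (t := W)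
        fun x hx => hRW x (List.mem_toFinset.1 hx)
      rw [List.toFinset_card_of_nodup a1] at this
      simpa using this
    · exact Finset.mem_filter.2 ⟨(Finset.mem_inter.1 (a4 h (by simp))).2, a6, a8⟩
    · exact Finset.mem_filter.2 ⟨(Finset.mem_inter.1 (a4 t (by simp))).2, a7, a9⟩
    · intro x hx
      exact (Finset.mem_inter.1 (a4 x (List.mem_toFinset.1 (Finset.mem_inter.1 hx).1))).1

end Witness

section Terminal

variable {V C : Type*}

/-- A family of pairwise disjoint pairs of vertices, each inside a colour class of `a`. -/
def ValidPairs (a : V → C) (P : Finset (V × V)) : Prop :=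
  (∀ o ∈ P, o.1 ≠ o.2 ∧ a o.1 = a o.2) ∧
  ∀ o ∈ P, ∀ o' ∈ P, (o.1 = o'.1 ∨ o.1 = o'.2 ∨ o.2 = o'.1 ∨ o.2 = o'.2) → o = o'

/-- The set of vertices covered by a family of pairs. -/
noncomputable def freed (P : Finset (V × V)) : Finset V := P.biUnion fun o => {o.1, o.2}

lemma mem_freed {P : Finset (V × V)} {v : V} :
    v ∈ freed P ↔ ∃ o ∈ P, v = o.1 ∨ v = o.2 := by
  simp [freed]

/-- The edge `f` can still become monochromatic of colour `i`, when only the vertices of `F` may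
change their colour from `a v` to `s (a v)`. -/
def Active (a : V → C) (s : C → C) (F f : Finset V) (i : C) : Prop :=
  ∀ v ∈ f, a v = i ∨ (s (a v) = i ∧ v ∈ F)

/-- The pairs meeting an edge. -/
noncomputable def owners (P : Finset (V × V)) (f : Finset V) : Finset (V × V) :=
  P.filter fun o => o.1 ∈ f ∨ o.2 ∈ f

/-- There is a colouring that is proper for `E` and separates all the pairs of `P`. -/
def SepColorable (C : Type*) {V : Type*} (P : Finset (V × V)) (E : Finset (Finset V)) : Prop :=
  ∃ c : V → C, (∀ o ∈ P, c o.1 ≠ c o.2) ∧ ∀ e ∈ E, ¬ Monochromatic c e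

lemma SepColorable.of_insert {P : Finset (V × V)} {E : Finset (Finset V)} {f : Finset V} {x y : V}
    (hx : x ∈ f) (hy : y ∈ f) (h : SepColorable C (insert (x, y) P) E) :
    SepColorable C P (insert f E) := by
  obtain ⟨c, h1, h2⟩ := h
  refine ⟨c, fun o ho => h1 o (Finset.mem_insert_of_mem ho), fun e he => ?_⟩
  rcases Finset.mem_insert.1 he with rfl | he
  · exact fun hm => h1 (x, y) (Finset.mem_insert_self _ _) (hm x hx y hy)
  · exact h2 e he

variable {a : V → C} {s : C → C} {P : Finset (V × V)}

lemma Active.unique (hs2 : ∀ j, s (s j) ≠ j) {F f : Finset V} (hf : ¬ Monochromatic a f)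
    {i j : C} (hi : Active a s F f i) (hj : Active a s F f j) : i = j := by
  by_contra hij
  refine hf fun v hv w hw => ?_
  by_contra hvw
  have h7 : s i = j → s j ≠ i := fun h h' => hs2 i (by rw [h, h'])
  rcases hi v hv with h3 | ⟨h3, -⟩ <;> rcases hj v hv with h4 | ⟨h4, -⟩ <;>
    rcases hi w hw with h5 | ⟨h5, -⟩ <;> rcases hj w hw with h6 | ⟨h6, -⟩ <;> simp_all

lemma terminal_colorable (hs1 : ∀ j, s j ≠ j) (hs2 : ∀ j, s (s j) ≠ j) (hP : ValidPairs a P)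
    {E : Finset (Finset V)} (hE : ∀ f ∈ E, ¬ Monochromatic a f)
    (h : ∃ φ : Finset V → V × V, Set.InjOn φ {f | f ∈ E ∧ ∃ i, Active a s (freed P) f i} ∧
      ∀ f ∈ E, (∃ i, Active a s (freed P) f i) → φ f ∈ owners P f) :
    SepColorable C P E := by
  obtain ⟨φ, hinj, hφ⟩ := h
  have hτ : ∀ o : V × V, ∃ b : Prop, ∀ f ∈ E, ∀ i, Active a s (freed P) f i → φ f = o →
      ((o.1 ∈ f ∧ (a o.1 = i ↔ b)) ∨ (o.2 ∈ f ∧ (a o.2 = i ↔ ¬ b))) := by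
    intro o
    by_cases hex : ∃ f ∈ E, ∃ i, Active a s (freed P) f i ∧ φ f = o
    · obtain ⟨f, hf, i, hi, ho⟩ := hex
      have key : ∀ b : Prop, ((o.1 ∈ f ∧ (a o.1 = i ↔ b)) ∨ (o.2 ∈ f ∧ (a o.2 = i ↔ ¬ b))) →
          ∀ f ∈ E, ∀ i, Active a s (freed P) f i → φ f = o →
          ((o.1 ∈ f ∧ (a o.1 = i ↔ b)) ∨ (o.2 ∈ f ∧ (a o.2 = i ↔ ¬ b))) := by
        intro b hb f' hf' i' hi' ho'
        have : f = f' := hinj ⟨hf, i, hi⟩ ⟨hf', i', hi'⟩ (ho.trans ho'.symm)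
        subst this
        rw [hi'.unique hs2 (hE f hf) hi]
        exact hb
      have hof := (Finset.mem_filter.1 (hφ f hf ⟨i, hi⟩)).2
      rw [ho] at hof
      rcases hof with h1 | h1
      · exact ⟨a o.1 = i, key _ (Or.inl ⟨h1, Iff.rfl⟩)⟩
      · exact ⟨a o.2 ≠ i, key _ (Or.inr ⟨h1, by simp⟩)⟩
    · exact ⟨True, fun f hf i hi ho => absurd ⟨f, hf, i, hi, ho⟩ hex⟩
  choose τ hτ using hτ
  set sw : V → Prop := fun v => ∃ o ∈ P, (τ o ∧ v = o.1) ∨ (¬ τ o ∧ v = o.2) with hsw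
  have sw1 : ∀ o ∈ P, sw o.1 ↔ τ o := by
    intro o ho
    constructor
    · rintro ⟨o', ho', ⟨h1, h2⟩ | ⟨h1, h2⟩⟩
      · rwa [hP.2 o ho o' ho' (Or.inl h2)]
      · have := hP.2 o ho o' ho' (Or.inr (Or.inl h2))
        subst this
        exact absurd h2 (hP.1 o ho).1
    · exact fun h => ⟨o, ho, Or.inl ⟨h, rfl⟩⟩
  have sw2 : ∀ o ∈ P, sw o.2 ↔ ¬ τ o := by
    intro o ho
    constructor
    · rintro ⟨o', ho', ⟨h1, h2⟩ | ⟨h1, h2⟩⟩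
      · have := hP.2 o ho o' ho' (Or.inr (Or.inr (Or.inl h2)))
        subst this
        exact absurd h2.symm (hP.1 o ho).1
      · rwa [hP.2 o ho o' ho' (Or.inr (Or.inr (Or.inr h2)))]
    · exact fun h => ⟨o, ho, Or.inr ⟨h, rfl⟩⟩
  have hswF : ∀ v, sw v → v ∈ freed P := by
    rintro v ⟨o, ho, ⟨-, h⟩ | ⟨-, h⟩⟩
    · exact mem_freed.2 ⟨o, ho, Or.inl h⟩
    · exact mem_freed.2 ⟨o, ho, Or.inr h⟩
  refine ⟨fun v => if sw v then s (a v) else a v, fun o ho => ?_, fun f hf hmono => ?_⟩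
  · have h1 := sw1 o ho
    have h2 := sw2 o ho
    have h3 := (hP.1 o ho).2
    by_cases ht : τ o
    · simp [h1, h2, ht, h3, hs1]
    · simp [h1, h2, ht, h3, (hs1 _).symm]
  · have hne : ∃ v, v ∈ f := by
      by_contra! hc
      exact hE f hf fun v hv => absurd hv (hc v)
    obtain ⟨v₀, hv₀⟩ := hne
    set i := if sw v₀ then s (a v₀) else a v₀ with hi
    have hcol : ∀ v ∈ f, (if sw v then s (a v) else a v) = i := fun v hv => hmono v hv v₀ hv₀
    have hact : Active a s (freed P) f i := by
      intro v hv
      have := hcol v hv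
      by_cases hv' : sw v
      · exact Or.inr ⟨by simpa [hv'] using this, hswF v hv'⟩
      · exact Or.inl (by simpa [hv'] using this)
    have hoP := (Finset.mem_filter.1 (hφ f hf ⟨i, hact⟩)).1
    rcases hτ _ f hf i hact rfl with ⟨h1, h2⟩ | ⟨h1, h2⟩
    · have h3 := hcol _ h1
      simp only [sw1 _ hoP] at h3
      split_ifs at h3 with h4
      · exact hs1 _ (h3.trans (h2.2 h4).symm)
      · exact h4 (h2.1 h3)
    · have h3 := hcol _ h1
      simp only [sw2 _ hoP] at h3
      by_cases h4 : ¬ τ (φ f)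
      · rw [if_pos h4] at h3
        exact hs1 _ (h3.trans (h2.2 h4).symm)
      · rw [if_neg h4] at h3
        exact h4 (h2.1 h3)

lemma owners_nonempty {f : Finset V} (hf : ¬ Monochromatic a f) {i : C}
    (hi : Active a s (freed P) f i) : (owners P f).Nonempty := by
  by_contra hne
  refine hf fun v hv w hw => ?_
  have key : ∀ v ∈ f, a v = i := by
    intro v hv
    rcases hi v hv with h | ⟨-, h⟩
    · exact h
    · obtain ⟨o, ho, h⟩ := mem_freed.1 h
      refine absurd ⟨o, Finset.mem_filter.2 ⟨ho, ?_⟩⟩ hne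
      rcases h with rfl | rfl <;> simp [hv]
  rw [key v hv, key w hw]

lemma card_owners_le (hP : ValidPairs a P) (f : Finset V) : (owners P f).card ≤ f.card := by
  refine Finset.card_le_card_of_injOn (fun o => if o.1 ∈ f then o.1 else o.2) ?_ ?_
  · intro o ho
    have := (Finset.mem_filter.1 ho).2
    by_cases h : o.1 ∈ f
    · simp [h]
    · simp only [h, if_false]
      simpa [h] using this
  · intro o ho o' ho' hoo
    refine hP.2 o (Finset.mem_filter.1 ho).1 o' (Finset.mem_filter.1 ho').1 ?_
    dsimp only at hoo
    split_ifs at hoo <;> tauto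

end Terminal

section TerminalProb

variable {V C : Type*} {a : V → C} {s : C → C} {P : Finset (V × V)} {k m B : ℕ}

lemma card_freed_class_le (hP : ValidPairs a P) {b : ℕ} (j : C)
    (hb : (P.filter fun o => a o.1 = j).card ≤ b) :
    ((freed P).filter fun v => a v = j).card ≤ 2 * b := by
  have : (freed P).filter (fun v => a v = j) ⊆
      (P.filter fun o => a o.1 = j).biUnion fun o => {o.1, o.2} := by
    intro v hv
    obtain ⟨hvF, rfl⟩ := Finset.mem_filter.1 hv
    obtain ⟨o, ho, h⟩ := mem_freed.1 hvF
    refine Finset.mem_biUnion.2 ⟨o, Finset.mem_filter.2 ⟨ho, ?_⟩, by simpa using h⟩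
    rcases h with rfl | rfl
    · rfl
    · exact (hP.1 o ho).2
  calc _ ≤ _ := Finset.card_le_card this
    _ ≤ (P.filter fun o => a o.1 = j).card * 2 :=
      Finset.card_biUnion_le_card_mul _ _ _ fun o _ => Finset.card_le_two
    _ ≤ _ := by omega

lemma card_pred_le (hs : Function.Injective s) {S : Finset V} {b : ℕ}
    (h : ∀ j, (S.filter fun v => a v = j).card ≤ b) (j : C) :
    (S.filter fun v => s (a v) = j).card ≤ b := by
  rcases (S.filter fun v => s (a v) = j).eq_empty_or_nonempty with h0 | ⟨w, hw⟩
  · simp [h0]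
  · refine (Finset.card_le_card fun v hv => ?_).trans (h (a w))
    rw [Finset.mem_filter] at hv hw ⊢
    exact ⟨hv.1, hs (hv.2.trans hw.2.symm)⟩

variable [Fintype V]

lemma card_poor_le (hs : Function.Injective s) (hk : 2 ≤ k)
    (hm : ∀ j, ((Finset.univ : Finset V).filter fun v => a v = j).card ≤ m)
    (hP : ValidPairs a P) (hB : ∀ j, (P.filter fun o => a o.1 = j).card ≤ B)
    {T : Finset (Finset V)} (hTk : ∀ f ∈ T, f.card = k)
    (hT : ∀ f ∈ T, ∃ i, Active a s (freed P) f i)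
    (hpoor : ∀ f ∈ T, (f \ freed P).card ≤ 1) (o : V × V) :
    (T.filter fun f => o ∈ owners P f).card ≤ 4 * ((4 * B).choose (k - 2) * (m + 2 * B)) := by
  set FF : C → Finset V := fun j => (freed P).filter (fun v => a v = j) ∪
    (freed P).filter (fun v => s (a v) = j) with hFF
  set Y : C → Finset V := fun j => (Finset.univ : Finset V).filter (fun v => a v = j) ∪
    (freed P).filter (fun v => s (a v) = j) with hY
  have hF1 : ∀ j, ((freed P).filter fun v => a v = j).card ≤ 2 * B := fun j =>
    card_freed_class_le hP j (hB j)
  have hF2 := card_pred_le hs hF1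
  have hFFc : ∀ j, (FF j).card ≤ 4 * B := fun j => by
    have h1 := hF1 j
    have h2 := hF2 j
    exact (Finset.card_union_le _ _).trans (by omega)
  have hYc : ∀ j, (Y j).card ≤ m + 2 * B := fun j => by
    have h1 := hm j
    have h2 := hF2 j
    exact (Finset.card_union_le _ _).trans (by omega)
  have hsub : T.filter (fun f => o ∈ owners P f) ⊆
      ({o.1, o.2} : Finset V).biUnion fun x => ({a x, s (a x)} : Finset C).biUnion fun j =>
        ((FF j).powersetCard (k - 2) ×ˢ Y j).image fun q => insert x (insert q.2 q.1) := by
    intro f hf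
    obtain ⟨hfT, hof⟩ := Finset.mem_filter.1 hf
    have hof := (Finset.mem_filter.1 hof).2
    obtain ⟨i, hi⟩ := hT f hfT
    obtain ⟨x, hxo, hxf⟩ : ∃ x ∈ ({o.1, o.2} : Finset V), x ∈ f := by
      rcases hof with h | h
      · exact ⟨o.1, by simp, h⟩
      · exact ⟨o.2, by simp, h⟩
    have hfY : f ⊆ Y i := by
      intro v hv
      rcases hi v hv with h | h
      · exact Finset.mem_union_left _ (by simpa using h)
      · exact Finset.mem_union_right _ (Finset.mem_filter.2 ⟨h.2, h.1⟩)
    have hfFF : ∀ v ∈ f, v ∈ freed P → v ∈ FF i := by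
      intro v hv hvF
      rcases hi v hv with h | h
      · exact Finset.mem_union_left _ (Finset.mem_filter.2 ⟨hvF, h⟩)
      · exact Finset.mem_union_right _ (Finset.mem_filter.2 ⟨hvF, h.1⟩)
    have hcard : (f.erase x).card = k - 1 := by rw [Finset.card_erase_of_mem hxf, hTk f hfT]
    obtain ⟨z, hz, hzF⟩ : ∃ z ∈ f.erase x, ∀ v ∈ (f.erase x).erase z, v ∈ freed P := by
      by_cases hex : ∃ z ∈ f.erase x, z ∉ freed P
      · obtain ⟨z, hz, hzF⟩ := hex
        refine ⟨z, hz, fun v hv => ?_⟩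
        by_contra hvF
        have hv' := Finset.mem_erase.1 hv
        refine hv'.1 (Finset.card_le_one.1 (hpoor f hfT) v ?_ z ?_)
        · exact Finset.mem_sdiff.2 ⟨Finset.mem_of_mem_erase hv'.2, hvF⟩
        · exact Finset.mem_sdiff.2 ⟨Finset.mem_of_mem_erase hz, hzF⟩
      · push Not at hex
        obtain ⟨z, hz⟩ : (f.erase x).Nonempty := Finset.card_pos.1 (by omega)
        exact ⟨z, hz, fun v hv => hex v (Finset.mem_of_mem_erase hv)⟩
    refine Finset.mem_biUnion.2 ⟨x, hxo, Finset.mem_biUnion.2 ⟨i, ?_, Finset.mem_image.2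
      ⟨((f.erase x).erase z, z), Finset.mem_product.2 ⟨Finset.mem_powersetCard.2 ⟨?_, ?_⟩,
        hfY (Finset.mem_of_mem_erase hz)⟩, ?_⟩⟩⟩
    · rcases hi x hxf with h | h
      · simp [h]
      · simp [h.1]
    · exact fun v hv => hfFF v (Finset.mem_of_mem_erase (Finset.mem_of_mem_erase hv)) (hzF v hv)
    · rw [Finset.card_erase_of_mem hz, hcard]; omega
    · dsimp only
      rw [Finset.insert_erase hz, Finset.insert_erase hxf]
  calc _ ≤ _ := Finset.card_le_card hsub
    _ ≤ ({o.1, o.2} : Finset V).card * (2 * ((4 * B).choose (k - 2) * (m + 2 * B))) := by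
      refine Finset.card_biUnion_le_card_mul _ _ _ fun x _ => ?_
      refine (Finset.card_biUnion_le_card_mul _ _ ((4 * B).choose (k - 2) * (m + 2 * B))
        fun j _ => ?_).trans (Nat.mul_le_mul_right _ Finset.card_le_two)
      refine Finset.card_image_le.trans ?_
      rw [Finset.card_product, Finset.card_powersetCard]
      exact Nat.mul_le_mul (Nat.choose_le_choose _ (hFFc j)) (hYc j)
    _ ≤ 2 * (2 * ((4 * B).choose (k - 2) * (m + 2 * B))) :=
      Nat.mul_le_mul_right _ Finset.card_le_two
    _ = _ := by ring

lemma card_closed_le (hk : 3 ≤ k) {T : Finset (Finset V)} (hTk : ∀ f ∈ T, f.card = k)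
    (hpoor : ∀ f ∈ T, (f \ freed P).card ≤ 1) (R : Finset (V × V)) (o : V × V) :
    (T.filter fun f => o ∈ owners P f ∧ owners P f ⊆ R).card ≤
      R.card * (4 * (Fintype.card V).choose (k - 2)) := by
  have hsub : T.filter (fun f => o ∈ owners P f ∧ owners P f ⊆ R) ⊆
      ({o.1, o.2} : Finset V).biUnion fun x => (freed R).biUnion fun y =>
        ((Finset.univ : Finset V).powersetCard (k - 2)).image fun q => insert x (insert y q) := by
    intro f hf
    obtain ⟨hfT, hof, hfR⟩ := Finset.mem_filter.1 hf
    have hof := (Finset.mem_filter.1 hof).2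
    obtain ⟨x, hxo, hxf⟩ : ∃ x ∈ ({o.1, o.2} : Finset V), x ∈ f := by
      rcases hof with h | h
      · exact ⟨o.1, by simp, h⟩
      · exact ⟨o.2, by simp, h⟩
    have hcard : (f.erase x).card = k - 1 := by rw [Finset.card_erase_of_mem hxf, hTk f hfT]
    obtain ⟨y, hy, hyF⟩ : ∃ y ∈ f.erase x, y ∈ freed P := by
      by_contra! hc
      have h1 : f.erase x ⊆ f \ freed P := fun v hv =>
        Finset.mem_sdiff.2 ⟨Finset.mem_of_mem_erase hv, hc v hv⟩
      have h2 := Finset.card_le_card h1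
      have h3 := hpoor f hfT
      omega
    have hyR : y ∈ freed R := by
      obtain ⟨o', ho', h⟩ := mem_freed.1 hyF
      refine mem_freed.2 ⟨o', hfR (Finset.mem_filter.2 ⟨ho', ?_⟩), h⟩
      have := Finset.mem_of_mem_erase hy
      rcases h with rfl | rfl <;> simp [this]
    refine Finset.mem_biUnion.2 ⟨x, hxo, Finset.mem_biUnion.2 ⟨y, hyR, Finset.mem_image.2
      ⟨(f.erase x).erase y, Finset.mem_powersetCard.2 ⟨Finset.subset_univ _, ?_⟩, ?_⟩⟩⟩
    · rw [Finset.card_erase_of_mem hy, hcard]; omega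
    · rw [Finset.insert_erase hy, Finset.insert_erase hxf]
  have hfR : (freed R).card ≤ R.card * 2 :=
    Finset.card_biUnion_le_card_mul _ _ _ fun o _ => Finset.card_le_two
  calc _ ≤ _ := Finset.card_le_card hsub
    _ ≤ ({o.1, o.2} : Finset V).card * ((R.card * 2) * (Fintype.card V).choose (k - 2)) := by
      refine Finset.card_biUnion_le_card_mul _ _ _ fun x _ => ?_
      refine (Finset.card_biUnion_le_card_mul _ _ ((Fintype.card V).choose (k - 2))
        fun j _ => ?_).trans (Nat.mul_le_mul_right _ hfR)
      refine Finset.card_image_le.trans ?_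
      rw [Finset.card_powersetCard, Finset.card_univ]
    _ ≤ 2 * ((R.card * 2) * (Fintype.card V).choose (k - 2)) :=
      Nat.mul_le_mul_right _ Finset.card_le_two
    _ = _ := by ring

lemma card_validPairs_le (hP : ValidPairs a P) : P.card ≤ Fintype.card V := by
  rw [← Finset.card_univ]
  exact Finset.card_le_card_of_injOn Prod.fst (fun _ _ => Finset.mem_coe.2 (Finset.mem_univ _))
    fun o ho o' ho' h => hP.2 o ho o' ho' (Or.inl h)

lemma expect_not_sepColorable_le [Nonempty V] {p : ℝ} (hp0 : 0 ≤ p) (hp1 : p ≤ 1)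
    (hs : Function.Injective s) (hs1 : ∀ j, s j ≠ j) (hs2 : ∀ j, s (s j) ≠ j) (hk : 3 ≤ k)
    (hm : ∀ j, ((Finset.univ : Finset V).filter fun v => a v = j).card ≤ m)
    (hP : ValidPairs a P) (hB : ∀ j, (P.filter fun o => a o.1 = j).card ≤ B)
    (hpB : p * k * (4 * ((4 * B).choose (k - 2) * (m + 2 * B)) : ℕ) ≤ 3 / 4)
    {U : Finset (Finset V)} (hUk : ∀ f ∈ U, f.card = k)
    (hU : ∀ f ∈ U, ¬ Monochromatic a f)
    (hpoor : ∀ f ∈ U, ∀ i, Active a s (freed P) f i → (f \ freed P).card ≤ 1) :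
    expect p U (fun E => ind (¬ SepColorable C P E)) ≤
      112 * Fintype.card V * (4 * p * (Fintype.card V).choose (k - 2)) ^ 2 := by
  set T := U.filter fun f => ∃ i, Active a s (freed P) f i with hT
  have hTU : T ⊆ U := Finset.filter_subset _ _
  have hTact : ∀ f ∈ T, ∃ i, Active a s (freed P) f i := fun f hf => (Finset.mem_filter.1 hf).2
  have hTpoor : ∀ f ∈ T, (f \ freed P).card ≤ 1 := fun f hf => by
    obtain ⟨i, hi⟩ := hTact f hf
    exact hpoor f (hTU hf) i hi
  have hTk : ∀ f ∈ T, f.card = k := fun f hf => hUk f (hTU hf)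
  have key := expect_not_sdr_le hp0 hp1 (O := owners P) hTU (W := P) (k := k)
    (κ := 4 * p * (Fintype.card V).choose (k - 2)) (by positivity)
    (fun f hf => by
      obtain ⟨i, hi⟩ := hTact f hf
      exact owners_nonempty (hU f (hTU hf)) hi)
    (fun f _ => Finset.filter_subset _ _)
    (fun f hf => (card_owners_le hP f).trans (hTk f hf).le)
    (fun o _ => le_trans (by
      have := card_poor_le hs (by omega) hm hP hB hTk hTact hTpoor o
      refine mul_le_mul_of_nonneg_left (Nat.cast_le.2 ?_) (by positivity)
      convert this) hpB)
    (fun R _ o _ => by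
      have := card_closed_le hk hTk hTpoor R o
      calc _ ≤ p * ((R.card * (4 * (Fintype.card V).choose (k - 2)) : ℕ) : ℝ) := by
            refine mul_le_mul_of_nonneg_left (Nat.cast_le.2 ?_) hp0
            convert this
        _ = _ := by push_cast; ring)
  refine (expect_mono hp0 hp1 fun E hE => ind_mono ?_).trans (key.trans ?_)
  · rw [not_imp_not]
    rintro ⟨φ, h1, h2⟩
    have hmem : ∀ f ∈ E, (∃ i, Active a s (freed P) f i) → f ∈ T := fun f hf hi =>
      Finset.mem_filter.2 ⟨hE hf, hi⟩
    refine terminal_colorable hs1 hs2 hP (fun f hf => hU f (hE hf)) ⟨φ, ?_, ?_⟩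
    · exact fun f hf g hg => h1 ⟨hf.1, hmem f hf.1 hf.2⟩ ⟨hg.1, hmem g hg.1 hg.2⟩
    · exact fun f hf hi => h2 f hf (hmem f hf hi)
  · have := card_validPairs_le hP
    gcongr

end TerminalProb

section Partial

variable {V C : Type*} {a : V → C} {s : C → C} {P : Finset (V × V)} {k m B : ℕ}

/-- The number of pairs of `P` in the colour class `j`. -/
noncomputable def pairCount (a : V → C) (P : Finset (V × V)) (j : C) : ℕ :=
  (P.filter fun o => a o.1 = j).card

/-- The number of edges of `U` which can become monochromatic of colour `j`. -/
noncomputable def activeCount (a : V → C) (s : C → C) (F : Finset V) (U : Finset (Finset V))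
    (j : C) : ℕ :=
  (U.filter fun f => Active a s F f j).card

lemma activeCount_mono {F F' : Finset V} {U U' : Finset (Finset V)} {j : C} (hU : U ⊆ U')
    (h : ∀ f ∈ U, Active a s F f j → Active a s F' f j) :
    activeCount a s F U j ≤ activeCount a s F' U' j := by
  refine Finset.card_le_card fun f hf => ?_
  obtain ⟨h1, h2⟩ := Finset.mem_filter.1 hf
  exact Finset.mem_filter.2 ⟨hU h1, h f h1 h2⟩

lemma activeCount_insert {F : Finset V} {U : Finset (Finset V)} {f : Finset V} {j : C}
    (hf : f ∉ U) (h : Active a s F f j) :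
    activeCount a s F (insert f U) j = activeCount a s F U j + 1 := by
  unfold activeCount
  rw [Finset.filter_insert, if_pos h, Finset.card_insert_of_notMem]
  exact fun hm => hf (Finset.mem_filter.1 hm).1

lemma ValidPairs.insert (hP : ValidPairs a P) {x y : V} (hx : x ∉ freed P) (hy : y ∉ freed P)
    (hxy : x ≠ y) (h : a x = a y) : ValidPairs a (insert (x, y) P) := by
  have h1 : ∀ o ∈ P, o.1 ≠ x ∧ o.2 ≠ x ∧ o.1 ≠ y ∧ o.2 ≠ y := by
    intro o ho
    refine ⟨?_, ?_, ?_, ?_⟩ <;> rintro rfl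
    · exact hx (mem_freed.2 ⟨o, ho, Or.inl rfl⟩)
    · exact hx (mem_freed.2 ⟨o, ho, Or.inr rfl⟩)
    · exact hy (mem_freed.2 ⟨o, ho, Or.inl rfl⟩)
    · exact hy (mem_freed.2 ⟨o, ho, Or.inr rfl⟩)
  refine ⟨fun o ho => ?_, fun o ho o' ho' hoo => ?_⟩
  · rcases Finset.mem_insert.1 ho with rfl | ho
    · exact ⟨hxy, h⟩
    · exact hP.1 o ho
  · rcases Finset.mem_insert.1 ho with rfl | ho <;> rcases Finset.mem_insert.1 ho' with rfl | ho'
    · rfl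
    · have := h1 o' ho'
      dsimp only at hoo
      tauto
    · have := h1 o ho
      dsimp only at hoo
      tauto
    · exact hP.2 o ho o' ho' hoo

lemma freed_insert (P : Finset (V × V)) (x y : V) :
    freed (insert (x, y) P) = insert x (insert y (freed P)) := by
  ext v
  simp [freed]

lemma pairCount_insert {x y : V} (hx : x ∉ freed P) (j : C) :
    pairCount a (insert (x, y) P) j = pairCount a P j + if a x = j then 1 else 0 := by
  unfold pairCount
  have : (x, y) ∉ P := fun h => hx (mem_freed.2 ⟨_, h, Or.inl rfl⟩)
  rw [Finset.filter_insert]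
  by_cases h : a x = j
  · simp only [h, if_true]
    rw [Finset.card_insert_of_notMem]
    exact fun hm => this (Finset.mem_filter.1 hm).1
  · simp [h]

lemma card_pred_freed_le (hs : Function.Injective s) (hP : ValidPairs a P) {i : C} {b : ℕ}
    (hi : pairCount a P i ≤ b) : ((freed P).filter fun v => s (a v) = s i).card ≤ 2 * b := by
  have := card_freed_class_le hP i hi
  convert this using 3
  exact hs.eq_iff

variable [Fintype V]

lemma card_active_through_le (U : Finset (Finset V)) (hUk : ∀ f ∈ U, f.card = k) {F : Finset V}
    {j : C} {b : ℕ} (hb : ((Finset.univ : Finset V).filter fun v => a v = j).card +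
      (F.filter fun v => s (a v) = j).card ≤ b) (v : V) :
    (U.filter fun f => v ∈ f ∧ Active a s F f j).card ≤ b.choose (k - 1) := by
  set Y : Finset V := (Finset.univ : Finset V).filter (fun v => a v = j) ∪
    F.filter (fun v => s (a v) = j) with hY
  have hsub : U.filter (fun f => v ∈ f ∧ Active a s F f j) ⊆
      (Y.powersetCard (k - 1)).image fun q => insert v q := by
    intro f hf
    obtain ⟨hfU, hv, hf⟩ := Finset.mem_filter.1 hf
    refine Finset.mem_image.2 ⟨f.erase v, Finset.mem_powersetCard.2 ⟨fun w hw => ?_, ?_⟩,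
      Finset.insert_erase hv⟩
    · rcases hf w (Finset.mem_of_mem_erase hw) with h | h
      · exact Finset.mem_union_left _ (by simpa using h)
      · exact Finset.mem_union_right _ (Finset.mem_filter.2 ⟨h.2, h.1⟩)
    · rw [Finset.card_erase_of_mem hv, hUk f hfU]
  refine (Finset.card_le_card hsub).trans (Finset.card_image_le.trans ?_)
  rw [Finset.card_powersetCard]
  exact Nat.choose_le_choose _ ((Finset.card_union_le _ _).trans hb)

lemma activeCount_succ_le (hs : Function.Injective s)
    (hm : ∀ j, ((Finset.univ : Finset V).filter fun v => a v = j).card ≤ m)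
    (hP : ValidPairs a P) {U : Finset (Finset V)} (hUk : ∀ f ∈ U, f.card = k)
    (hU : ∀ f ∈ U, ¬ Monochromatic a f) {i : C} (hi : pairCount a P i ≤ B) :
    activeCount a s (freed P) U (s i) ≤
      2 * pairCount a P i * (m + 2 * B + 2).choose (k - 1) := by
  have hsub : U.filter (fun f => Active a s (freed P) f (s i)) ⊆
      ((freed P).filter fun v => s (a v) = s i).biUnion fun v =>
        U.filter fun f => v ∈ f ∧ Active a s (freed P) f (s i) := by
    intro f hf
    obtain ⟨hfU, hf⟩ := Finset.mem_filter.1 hf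
    have : ∃ v ∈ f, a v ≠ s i := by
      by_contra! hc
      exact hU f hfU fun v hv w hw => by rw [hc v hv, hc w hw]
    obtain ⟨v, hv, hav⟩ := this
    obtain ⟨h1, h2⟩ := (hf v hv).resolve_left hav
    exact Finset.mem_biUnion.2 ⟨v, Finset.mem_filter.2 ⟨h2, h1⟩,
      Finset.mem_filter.2 ⟨hfU, hv, hf⟩⟩
  refine (Finset.card_le_card hsub).trans ?_
  refine (Finset.card_biUnion_le_card_mul _ _ ((m + 2 * B + 2).choose (k - 1))
    fun v _ => card_active_through_le U hUk ?_ v).trans ?_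
  · have h1 := hm (s i)
    have h2 := card_pred_freed_le hs hP hi
    omega
  · exact Nat.mul_le_mul_right _ (card_pred_freed_le hs hP le_rfl)

lemma activeCount_insert_pair_le (hs : Function.Injective s)
    (hm : ∀ j, ((Finset.univ : Finset V).filter fun v => a v = j).card ≤ m)
    {x y : V} (hP : ValidPairs a (insert (x, y) P)) (hx : x ∉ freed P)
    {U : Finset (Finset V)} (hUk : ∀ f ∈ U, f.card = k) (hB : pairCount a P (a x) ≤ B) (j : C) :
    activeCount a s (freed (insert (x, y) P)) U j ≤ activeCount a s (freed P) U j +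
      if j = s (a x) then 2 * (m + 2 * B + 2).choose (k - 1) else 0 := by
  have hxy : a x = a y := (hP.1 (x, y) (Finset.mem_insert_self _ _)).2
  set F' := freed (insert (x, y) P) with hF'
  have hF'' : F' = insert x (insert y (freed P)) := freed_insert P x y
  have hout : ∀ f, Active a s F' f j → (¬ (j = s (a x)) ∨ (x ∉ f ∧ y ∉ f)) →
      Active a s (freed P) f j := by
    intro f hf h v hv
    rcases hf v hv with h1 | ⟨h1, h2⟩
    · exact Or.inl h1
    · rw [hF'', Finset.mem_insert, Finset.mem_insert] at h2
      rcases h2 with rfl | rfl | h2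
      · rcases h with h | h
        · exact absurd h1.symm h
        · exact absurd hv h.1
      · rcases h with h | h
        · exact absurd (hxy ▸ h1.symm) h
        · exact absurd hv h.2
      · exact Or.inr ⟨h1, h2⟩
  split_ifs with hj
  · subst hj
    have hsub : U.filter (fun f => Active a s F' f (s (a x))) ⊆
        U.filter (fun f => Active a s (freed P) f (s (a x))) ∪
        ((U.filter fun f => x ∈ f ∧ Active a s F' f (s (a x))) ∪
          (U.filter fun f => y ∈ f ∧ Active a s F' f (s (a x)))) := by
      intro f hf
      obtain ⟨hfU, hf⟩ := Finset.mem_filter.1 hf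
      simp only [Finset.mem_union, Finset.mem_filter]
      by_cases h1 : x ∈ f
      · exact Or.inr (Or.inl ⟨hfU, h1, hf⟩)
      · by_cases h2 : y ∈ f
        · exact Or.inr (Or.inr ⟨hfU, h2, hf⟩)
        · exact Or.inl ⟨hfU, hout f hf (Or.inr ⟨h1, h2⟩)⟩
    have hb : ((Finset.univ : Finset V).filter fun v => a v = s (a x)).card +
        (F'.filter fun v => s (a v) = s (a x)).card ≤ m + 2 * B + 2 := by
      have h1 := hm (s (a x))
      have h2 := card_pred_freed_le hs hP (i := a x) (b := B + 1)
        (by rw [pairCount_insert hx]; simpa using hB)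
      have h3 : (F'.filter fun v => s (a v) = s (a x)).card ≤ 2 * (B + 1) := by
        convert h2
      omega
    have e1 := card_active_through_le U hUk hb x
    have e2 := card_active_through_le U hUk hb y
    have e3 := Finset.card_le_card hsub
    have e4 := Finset.card_union_le (U.filter (fun f => Active a s (freed P) f (s (a x))))
        ((U.filter fun f => x ∈ f ∧ Active a s F' f (s (a x))) ∪
          (U.filter fun f => y ∈ f ∧ Active a s F' f (s (a x))))
    have e5 := Finset.card_union_le (U.filter fun f => x ∈ f ∧ Active a s F' f (s (a x)))
          (U.filter fun f => y ∈ f ∧ Active a s F' f (s (a x)))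
    unfold activeCount
    omega
  · exact activeCount_mono (Finset.Subset.refl _) fun f _ hf => hout f hf (Or.inl hj)

end Partial

section Supermartingale

variable {V C : Type*} [Fintype V] [Fintype C] {a : V → C} {s : C → C} {k m B : ℕ}

lemma expect_process_le {p ε : ℝ} (hp0 : 0 ≤ p) (hp1 : p ≤ 1) (hε : 0 ≤ ε)
    (hs : Function.Injective s)
    (hm : ∀ j, ((Finset.univ : Finset V).filter fun v => a v = j).card ≤ m)
    {w : C → C → ℝ} (hw0 : ∀ j i, 0 ≤ w j i)
    (hw : ∀ j i, Real.exp ((if i = j then 1 else 0) +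
      p * (2 * (m + 2 * B + 2).choose (k - 1) : ℕ) * w j (s i)) - 1 ≤ w j i)
    (hterm : ∀ P : Finset (V × V), ValidPairs a P → (∀ j, pairCount a P j ≤ B) →
      ∀ U : Finset (Finset V), (∀ f ∈ U, f.card = k) → (∀ f ∈ U, ¬ Monochromatic a f) →
      (∀ f ∈ U, ∀ i, Active a s (freed P) f i → (f \ freed P).card ≤ 1) →
      expect p U (fun E => ind (¬ SepColorable C P E)) ≤ ε) (N : ℕ) :
    ∀ (P : Finset (V × V)) (U : Finset (Finset V)), U.card = N → ValidPairs a P →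
      (∀ f ∈ U, f.card = k) → (∀ f ∈ U, ¬ Monochromatic a f) →
      expect p U (fun E => ind (¬ SepColorable C P E)) ≤
        ε + ∑ j, Real.exp (pairCount a P j - B +
          p * ∑ i, w j i * activeCount a s (freed P) U i) := by
  set D : ℕ := 2 * (m + 2 * B + 2).choose (k - 1) with hD
  have hpos : ∀ (P : Finset (V × V)) (U : Finset (Finset V)), 0 ≤ ∑ j, Real.exp
      (pairCount a P j - B + p * ∑ i, w j i * activeCount a s (freed P) U i) := fun P U =>
    Finset.sum_nonneg fun j _ => (Real.exp_pos _).le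
  induction N using Nat.strong_induction_on with
  | _ N ih =>
  intro P U hUN hP hUk hU
  by_cases hcap : ∀ j, pairCount a P j ≤ B
  swap
  · push Not at hcap
    obtain ⟨j, hj⟩ := hcap
    have h1 : (1 : ℝ) ≤ Real.exp (pairCount a P j - B +
        p * ∑ i, w j i * activeCount a s (freed P) U i) := by
      refine Real.one_le_exp (add_nonneg ?_ (mul_nonneg hp0 (Finset.sum_nonneg fun i _ =>
        mul_nonneg (hw0 j i) (Nat.cast_nonneg _))))
      have : (B : ℝ) ≤ pairCount a P j := by exact_mod_cast hj.le
      linarith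
    have h2 := Finset.single_le_sum (f := fun j => Real.exp (pairCount a P j - B +
        p * ∑ i, w j i * activeCount a s (freed P) U i)) (fun j _ => (Real.exp_pos _).le)
        (Finset.mem_univ j)
    have h3 := expect_indicator_le_one hp0 hp1 U (fun E => ¬ SepColorable C P E)
    linarith
  by_cases hpoor : ∀ f ∈ U, ∀ i, Active a s (freed P) f i → (f \ freed P).card ≤ 1
  · exact (hterm P hP hcap U hUk hU hpoor).trans (le_add_of_nonneg_right (hpos P U))
  push Not at hpoor
  obtain ⟨f, hf, i, hi, hrich⟩ := hpoor
  obtain ⟨x, hx, y, hy, hxy⟩ := Finset.one_lt_card.1 hrich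
  obtain ⟨hxf, hxF⟩ := Finset.mem_sdiff.1 hx
  obtain ⟨hyf, hyF⟩ := Finset.mem_sdiff.1 hy
  have hax : a x = i := (hi x hxf).resolve_right fun h => hxF h.2
  have hay : a y = i := (hi y hyf).resolve_right fun h => hyF h.2
  have hP' := hP.insert hxF hyF hxy (hax.trans hay.symm)
  obtain ⟨U₀, hfU₀, rfl⟩ : ∃ U₀, f ∉ U₀ ∧ insert f U₀ = U :=
    ⟨U.erase f, Finset.notMem_erase _ _, Finset.insert_erase hf⟩
  have hcard : U₀.card < N := by
    rw [← hUN, Finset.card_insert_of_notMem hfU₀]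
    exact Nat.lt_succ_self _
  have hU₀k : ∀ g ∈ U₀, g.card = k := fun g hg => hUk g (Finset.mem_insert_of_mem hg)
  have hU₀ : ∀ g ∈ U₀, ¬ Monochromatic a g := fun g hg => hU g (Finset.mem_insert_of_mem hg)
  have ih1 := ih _ hcard (insert (x, y) P) U₀ rfl hP' hU₀k hU₀
  have ih2 := ih _ hcard P U₀ rfl hP hU₀k hU₀
  rw [expect_insert hfU₀]
  have hone : expect p U₀ (fun E => ind (¬ SepColorable C P (insert f E))) ≤
      expect p U₀ (fun E => ind (¬ SepColorable C (insert (x, y) P) E)) :=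
    expect_mono hp0 hp1 fun E _ => ind_mono fun h h' => h (h'.of_insert hxf hyf)
  have hp1' : 0 ≤ 1 - p := by linarith
  have hphi : ∀ j,
      p * Real.exp (pairCount a (insert (x, y) P) j - B +
        p * ∑ i, w j i * activeCount a s (freed (insert (x, y) P)) U₀ i) +
      (1 - p) * Real.exp (pairCount a P j - B +
        p * ∑ i, w j i * activeCount a s (freed P) U₀ i) ≤
      Real.exp (pairCount a P j - B +
        p * ∑ i, w j i * activeCount a s (freed P) (insert f U₀) i) := by
    intro j
    set X : ℝ := pairCount a P j - B + p * ∑ i, w j i * activeCount a s (freed P) U₀ i with hX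
    have e1 : (pairCount a (insert (x, y) P) j : ℝ) - B +
        p * ∑ i, w j i * activeCount a s (freed (insert (x, y) P)) U₀ i ≤
        X + ((if i = j then 1 else 0) + p * D * w j (s i)) := by
      rw [pairCount_insert hxF, hax]
      have : ∑ l, w j l * (activeCount a s (freed (insert (x, y) P)) U₀ l : ℝ) ≤
          ∑ l, w j l * activeCount a s (freed P) U₀ l + D * w j (s i) := by
        calc _ ≤ ∑ l, (w j l * activeCount a s (freed P) U₀ l +
              if l = s i then D * w j (s i) else 0) := by
              refine Finset.sum_le_sum fun l _ => ?_
              have h := activeCount_insert_pair_le hs hm hP' hxF hU₀k (hcap (a x)) l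
              rw [hax] at h
              by_cases hl : l = s i
              · simp only [hl, if_true] at h ⊢
                have h' : (activeCount a s (freed (insert (x, y) P)) U₀ (s i) : ℝ) ≤
                  activeCount a s (freed P) U₀ (s i) + D := by exact_mod_cast h
                nlinarith [hw0 j (s i)]
              · simp only [hl, if_false, add_zero] at h ⊢
                exact mul_le_mul_of_nonneg_left (by exact_mod_cast h) (hw0 j l)
          _ = _ := by
              rw [Finset.sum_add_distrib]
              simp
      have := mul_le_mul_of_nonneg_left this hp0
      rw [hX]
      push_cast
      linarith
    have e2 : X + p * w j i ≤ pairCount a P j - B +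
        p * ∑ i, w j i * activeCount a s (freed P) (insert f U₀) i := by
      have : ∑ l, w j l * (activeCount a s (freed P) U₀ l : ℝ) + w j i ≤
          ∑ l, w j l * (activeCount a s (freed P) (insert f U₀) l : ℝ) := by
        calc _ = ∑ l, (w j l * (activeCount a s (freed P) U₀ l : ℝ) +
              if l = i then w j i else 0) := by
              rw [Finset.sum_add_distrib]
              simp
          _ ≤ _ := by
              refine Finset.sum_le_sum fun l _ => ?_
              by_cases hl : l = i
              · subst hl
                rw [activeCount_insert hfU₀ hi]
                push_cast
                simp only [if_true]
                linarith
              · simp only [hl, if_false, add_zero]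
                refine mul_le_mul_of_nonneg_left (Nat.cast_le.2 ?_) (hw0 j l)
                exact activeCount_mono (Finset.subset_insert _ _) fun _ _ h => h
      have := mul_le_mul_of_nonneg_left this hp0
      rw [hX]
      linarith
    have e3 : p * Real.exp (X + ((if i = j then 1 else 0) + p * D * w j (s i))) +
        (1 - p) * Real.exp X ≤ Real.exp (X + p * w j i) := by
      clear_value X
      rw [Real.exp_add X, Real.exp_add X]
      have h1 := hw j i
      have h2 := Real.add_one_le_exp (p * w j i)
      have h3 := mul_le_mul_of_nonneg_left h1 hp0
      have h4 := Real.exp_pos X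
      have h5 := mul_le_mul_of_nonneg_left (h3.trans (le_sub_iff_add_le.2 h2)) h4.le
      generalize Real.exp ((if i = j then 1 else 0) + p * D * w j (s i)) = Y at *
      nlinarith
    have e4 := mul_le_mul_of_nonneg_left (Real.exp_le_exp.2 e1) hp0
    have e5 := Real.exp_le_exp.2 e2
    linarith
  have hsum := Finset.sum_le_sum fun j (_ : j ∈ Finset.univ) => hphi j
  rw [Finset.sum_add_distrib, ← Finset.mul_sum, ← Finset.mul_sum] at hsum
  have h1 := mul_le_mul_of_nonneg_left (hone.trans ih1) hp0
  have h2 := mul_le_mul_of_nonneg_left ih2 hp1'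
  have h3 : p * ε + (1 - p) * ε = ε := by ring
  linarith

end Supermartingale

section TwoSdr

variable {V C : Type*} {a : V → C}

/-- Every edge of `M` can be given two private vertices. -/
def TwoSdr {V : Type*} (M : Finset (Finset V)) : Prop :=
  ∃ φ : Finset V × Bool → V, Set.InjOn φ {x | x.1 ∈ M} ∧ ∀ e ∈ M, ∀ b, φ (e, b) ∈ e

lemma TwoSdr.exists_validPairs {M : Finset (Finset V)} (h : TwoSdr M)
    {col : Finset V → C} (hM : ∀ e ∈ M, ∀ v ∈ e, a v = col e) :
    ∃ P, ValidPairs a P ∧ (∀ e ∈ M, ∃ o ∈ P, o.1 ∈ e ∧ o.2 ∈ e) ∧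
      ∀ j, pairCount a P j ≤ (M.filter fun e => col e = j).card := by
  obtain ⟨φ, hinj, hφ⟩ := h
  refine ⟨M.image fun e => (φ (e, true), φ (e, false)), ⟨?_, ?_⟩, ?_, ?_⟩
  · intro o ho
    obtain ⟨e, he, rfl⟩ := Finset.mem_image.1 ho
    refine ⟨fun h => ?_, ?_⟩
    · have := hinj (x₁ := (e, true)) (x₂ := (e, false)) he he h
      simp at this
    · exact (hM e he _ (hφ e he true)).trans (hM e he _ (hφ e he false)).symm
  · intro o ho o' ho' hoo
    obtain ⟨e, he, rfl⟩ := Finset.mem_image.1 ho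
    obtain ⟨e', he', rfl⟩ := Finset.mem_image.1 ho'
    have key : ∀ b b', φ (e, b) = φ (e', b') → e = e' := fun b b' h =>
      congrArg Prod.fst (hinj (x₁ := (e, b)) (x₂ := (e', b')) he he' h)
    have : e = e' := by
      rcases hoo with h | h | h | h <;> exact key _ _ h
    rw [this]
  · intro e he
    exact ⟨_, Finset.mem_image_of_mem _ he, hφ e he true, hφ e he false⟩
  · intro j
    unfold pairCount
    rw [Finset.filter_image]
    refine Finset.card_image_le.trans (Finset.card_le_card fun e he => ?_)
    obtain ⟨he, h⟩ := Finset.mem_filter.1 he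
    exact Finset.mem_filter.2 ⟨he, (hM e he _ (hφ e he true)).symm.trans h⟩

variable [Fintype C]

lemma exists_dense_of_not_twoSdr [Nonempty V] {M : Finset (Finset V)} (h : ¬ TwoSdr M)
    {col : Finset V → C} (hM : ∀ e ∈ M, ∀ v ∈ e, a v = col e) :
    ∃ j, ∃ S : Finset V, (∀ v ∈ S, a v = j) ∧ ∃ A ⊆ M, (∀ e ∈ A, e ⊆ S) ∧
      A.card = S.card / 2 + 1 := by
  have hviol : ∃ A' ⊆ M ×ˢ (Finset.univ : Finset Bool),
      (A'.biUnion fun x => x.1).card < A'.card := by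
    by_contra! hc
    obtain ⟨φ, h1, h2⟩ := exists_injOn_of_hall (fun x : Finset V × Bool => x.1) _ hc
    refine h ⟨φ, fun x hx y hy => h1 ?_ ?_, fun e he b => h2 (e, b) (by simp [he])⟩
    · have : x.1 ∈ M := hx
      simp [this]
    · have : y.1 ∈ M := hy
      simp [this]
  obtain ⟨A', hA', hlt⟩ := hviol
  set A := A'.image Prod.fst with hA
  have hAM : A ⊆ M := fun e he => by
    obtain ⟨x, hx, rfl⟩ := Finset.mem_image.1 he
    exact (Finset.mem_product.1 (hA' hx)).1
  have hAc : A'.card ≤ 2 * A.card := by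
    have : A' ⊆ A ×ˢ (Finset.univ : Finset Bool) := fun x hx =>
      Finset.mem_product.2 ⟨Finset.mem_image_of_mem _ hx, Finset.mem_univ _⟩
    have := Finset.card_le_card this
    rw [Finset.card_product] at this
    simp at this
    omega
  have hU : A'.biUnion (fun x => x.1) = A.biUnion id := by
    rw [hA, Finset.image_biUnion]
    rfl
  rw [hU] at hlt
  set Aj : C → Finset (Finset V) := fun j => A.filter fun e => col e = j with hAj
  have hex : ∃ j, ((Aj j).biUnion id).card < 2 * (Aj j).card := by
    by_contra! hc
    have h1 : (A.biUnion id).card = ∑ j, ((A.biUnion id).filter fun v => a v = j).card :=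
      Finset.card_eq_sum_card_fiberwise fun _ _ => Finset.mem_coe.2 (Finset.mem_univ _)
    have h2 : A.card = ∑ j, (Aj j).card :=
      Finset.card_eq_sum_card_fiberwise fun _ _ => Finset.mem_coe.2 (Finset.mem_univ _)
    have h3 : ∑ j, 2 * (Aj j).card ≤ ∑ j, ((A.biUnion id).filter fun v => a v = j).card := by
      refine Finset.sum_le_sum fun j _ => (hc j).trans (Finset.card_le_card fun v hv => ?_)
      obtain ⟨e, he, hv⟩ := Finset.mem_biUnion.1 hv
      obtain ⟨heA, hej⟩ := Finset.mem_filter.1 he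
      exact Finset.mem_filter.2 ⟨Finset.mem_biUnion.2 ⟨e, heA, hv⟩,
        (hM e (hAM heA) v hv).trans hej⟩
    rw [← Finset.mul_sum] at h3
    omega
  obtain ⟨j, hj⟩ := hex
  obtain ⟨A₁, hA₁, hA₁c⟩ := Finset.exists_subset_card_eq (s := Aj j)
    (n := ((Aj j).biUnion id).card / 2 + 1) (by omega)
  refine ⟨j, (Aj j).biUnion id, fun v hv => ?_, A₁, fun e he => ?_, fun e he => ?_, hA₁c⟩
  · obtain ⟨e, he, hv⟩ := Finset.mem_biUnion.1 hv
    obtain ⟨heA, hej⟩ := Finset.mem_filter.1 he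
    exact (hM e (hAM heA) v hv).trans hej
  · exact hAM (Finset.mem_filter.1 (hA₁ he)).1
  · exact fun v hv => Finset.mem_biUnion.2 ⟨e, hA₁ he, hv⟩

variable [Fintype V]

lemma expect_not_twoSdr_le [Nonempty V] {p : ℝ} (hp0 : 0 ≤ p) (hp1 : p ≤ 1) {k m : ℕ}
    (hm : ∀ j, ((Finset.univ : Finset V).filter fun v => a v = j).card ≤ m)
    {Q : Finset (Finset V)} (hQk : ∀ e ∈ Q, e.card = k) {col : Finset V → C}
    (hQ : ∀ e ∈ Q, ∀ v ∈ e, a v = col e) :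
    expect p Q (fun M => ind (¬ TwoSdr M)) ≤ Fintype.card C *
      ∑ σ ∈ Finset.range (m + 1), (m.choose σ * (σ.choose k).choose (σ / 2 + 1) : ℕ) *
        p ^ (σ / 2 + 1) := by
  set cls : C → Finset V := fun j => (Finset.univ : Finset V).filter fun v => a v = j with hcls
  set I : Finset ((_ : C) × (_ : Finset V) × Finset (Finset V)) :=
    (Finset.univ : Finset C).sigma fun j => (cls j).powerset.sigma fun S =>
      (S.powersetCard k).powersetCard (S.card / 2 + 1) with hI
  have hmain := expect_le_sum_pow hp0 hp1 (Q := Q) (fun M => ¬ TwoSdr M)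
    (I.filter fun i => i.2.2 ⊆ Q) (fun i => i.2.2) (fun i hi => (Finset.mem_filter.1 hi).2) ?_
  · refine hmain.trans ?_
    have hle : ∑ i ∈ I.filter (fun i => i.2.2 ⊆ Q), p ^ i.2.2.card ≤ ∑ i ∈ I, p ^ i.2.2.card :=
      Finset.sum_le_sum_of_subset_of_nonneg (Finset.filter_subset _ _) fun i _ _ => by positivity
    refine hle.trans ?_
    rw [hI, Finset.sum_sigma]
    have hj : ∀ j ∈ (Finset.univ : Finset C), ∑ x ∈ (cls j).powerset.sigma fun S =>
        (S.powersetCard k).powersetCard (S.card / 2 + 1), p ^ x.2.card ≤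
        ∑ σ ∈ Finset.range (m + 1), (m.choose σ * (σ.choose k).choose (σ / 2 + 1) : ℕ) *
          p ^ (σ / 2 + 1) := by
      intro j _
      rw [Finset.sum_sigma]
      have h1 : ∀ S ∈ (cls j).powerset, ∑ A ∈ (S.powersetCard k).powersetCard (S.card / 2 + 1),
          p ^ A.card = ((S.card.choose k).choose (S.card / 2 + 1) : ℝ) *
            p ^ (S.card / 2 + 1) := by
        intro S _
        rw [Finset.sum_congr rfl fun A hA => by rw [(Finset.mem_powersetCard.1 hA).2],
          Finset.sum_const, nsmul_eq_mul, Finset.card_powersetCard, Finset.card_powersetCard]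
      rw [Finset.sum_congr rfl h1, Finset.sum_powerset_apply_card
        (fun σ => ((σ.choose k).choose (σ / 2 + 1) : ℝ) * p ^ (σ / 2 + 1))]
      have h2 : (cls j).card + 1 ≤ m + 1 := Nat.succ_le_succ (hm j)
      refine (Finset.sum_le_sum fun σ _ => ?_).trans
        (Finset.sum_le_sum_of_subset_of_nonneg (Finset.range_mono h2)
          fun _ _ _ => by positivity)
      rw [nsmul_eq_mul, Nat.cast_mul, mul_assoc]
      have := Nat.choose_le_choose σ (hm j)
      gcongr
    refine (Finset.sum_le_sum hj).trans_eq ?_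
    rw [Finset.sum_const, nsmul_eq_mul, Finset.card_univ]
  · intro M hMQ hM
    obtain ⟨j, S, hS, A, hAM, hAS, hAc⟩ := exists_dense_of_not_twoSdr hM
      fun e he => hQ e (hMQ he)
    refine ⟨⟨j, S, A⟩, Finset.mem_filter.2 ⟨?_, hAM.trans hMQ⟩, hAM⟩
    simp only [hI, Finset.mem_sigma, Finset.mem_univ, true_and, Finset.mem_powerset,
      Finset.mem_powersetCard]
    exact ⟨fun v hv => by simp [hcls, hS v hv],
      fun e he => Finset.mem_powersetCard.2 ⟨hAS e he, hQk e (hMQ (hAM he))⟩, hAc⟩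

end TwoSdr

section Combine

variable {V C : Type*} [Fintype V] {a : V → C} {s : C → C} {k m B : ℕ}

lemma card_class_edges_le
    (hm : ∀ j, ((Finset.univ : Finset V).filter fun v => a v = j).card ≤ m)
    {Q : Finset (Finset V)} (hQk : ∀ e ∈ Q, e.card = k) {col : Finset V → C}
    (hQ : ∀ e ∈ Q, ∀ v ∈ e, a v = col e) (j : C) :
    (Q.filter fun e => col e = j).card ≤ m.choose k := by
  calc (Q.filter fun e => col e = j).card
      ≤ (((Finset.univ : Finset V).filter fun v => a v = j).powersetCard k).card := by
        refine Finset.card_le_card fun e he => ?_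
        obtain ⟨heQ, hej⟩ := Finset.mem_filter.1 he
        refine Finset.mem_powersetCard.2 ⟨fun v hv => ?_, hQk e heQ⟩
        simp [hQ e heQ v hv, hej]
    _ ≤ m.choose k := by
        rw [Finset.card_powersetCard]
        exact Nat.choose_le_choose k (hm j)

variable [Fintype C]

lemma sum_card_filter_eq_mul {α : Type*} (M : Finset α) (col : α → C) (g : C → ℝ) :
    ∑ e ∈ M, g (col e) = ∑ i, g i * ((M.filter fun e => col e = i).card : ℝ) := by
  rw [← Finset.sum_fiberwise_of_maps_to (g := col) (t := Finset.univ) fun _ _ => Finset.mem_univ _]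
  refine Finset.sum_congr rfl fun i _ => ?_
  rw [Finset.sum_congr rfl fun e he => by rw [(Finset.mem_filter.1 he).2], Finset.sum_const,
    nsmul_eq_mul, mul_comm]

lemma expect_exp_mono_edges_le {p W : ℝ} (hp0 : 0 ≤ p) (hp1 : p ≤ 1)
    (hm : ∀ j, ((Finset.univ : Finset V).filter fun v => a v = j).card ≤ m)
    {Q : Finset (Finset V)} (hQk : ∀ e ∈ Q, e.card = k) {col : Finset V → C}
    (hQ : ∀ e ∈ Q, ∀ v ∈ e, a v = col e) {u g : C → ℝ} (hg0 : ∀ i, 0 ≤ g i)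
    (hu : ∀ i, Real.exp (u i) - 1 ≤ g i) (hW : ∑ i, g i ≤ W) (b : ℝ) :
    expect p Q (fun M => Real.exp (-b + ∑ e ∈ M, u (col e))) ≤
      Real.exp (-b + p * (W * m.choose k)) := by
  have h1 : expect p Q (fun M => Real.exp (-b + ∑ e ∈ M, u (col e))) =
      Real.exp (-b) * ∏ e ∈ Q, (1 + p * (Real.exp (u (col e)) - 1)) := by
    rw [← expect_prod, ← expect_const_mul]
    refine expect_congr fun M _ => ?_
    rw [Real.exp_add, Real.exp_sum]
  rw [h1, Real.exp_add]
  refine mul_le_mul_of_nonneg_left ?_ (Real.exp_pos _).le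
  have h2 : ∏ e ∈ Q, (1 + p * (Real.exp (u (col e)) - 1)) ≤ ∏ e ∈ Q, Real.exp (p * g (col e)) := by
    refine Finset.prod_le_prod (fun e _ => ?_) fun e _ => ?_
    · have := mul_nonneg hp0 (Real.exp_pos (u (col e))).le
      linarith
    · have h3 := mul_le_mul_of_nonneg_left (hu (col e)) hp0
      have h4 := Real.add_one_le_exp (p * g (col e))
      linarith
  refine h2.trans ?_
  rw [← Real.exp_sum, Real.exp_le_exp, ← Finset.mul_sum]
  refine mul_le_mul_of_nonneg_left ?_ hp0
  rw [sum_card_filter_eq_mul Q col g]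
  calc ∑ i, g i * ((Q.filter fun e => col e = i).card : ℝ) ≤ ∑ i, g i * (m.choose k : ℝ) := by
        refine Finset.sum_le_sum fun i _ => mul_le_mul_of_nonneg_left ?_ (hg0 i)
        exact_mod_cast card_class_edges_le hm hQk hQ i
    _ = (∑ i, g i) * m.choose k := by rw [Finset.sum_mul]
    _ ≤ W * m.choose k := mul_le_mul_of_nonneg_right hW (Nat.cast_nonneg _)

lemma exp_pairs_le_exp_mono_edges {p : ℝ} (hp0 : 0 ≤ p) (hs : Function.Injective s)
    (hm : ∀ j, ((Finset.univ : Finset V).filter fun v => a v = j).card ≤ m)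
    {w : C → C → ℝ} (hw0 : ∀ j i, 0 ≤ w j i) {P : Finset (V × V)} (hP : ValidPairs a P)
    (hcap : ∀ j, pairCount a P j ≤ B)
    {U : Finset (Finset V)} (hUk : ∀ f ∈ U, f.card = k) (hU : ∀ f ∈ U, ¬ Monochromatic a f)
    {M : Finset (Finset V)} {col : Finset V → C}
    (hPM : ∀ j, pairCount a P j ≤ (M.filter fun e => col e = j).card) (j : C) :
    Real.exp (pairCount a P j - B + p * ∑ i, w j i * activeCount a s (freed P) U i) ≤
      Real.exp (-B + ∑ e ∈ M, ((if col e = j then 1 else 0) +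
        p * (2 * (m + 2 * B + 2).choose (k - 1) : ℕ) * w j (s (col e)))) := by
  rw [Real.exp_le_exp, Finset.sum_add_distrib, Finset.sum_boole]
  have h1 : (pairCount a P j : ℝ) ≤ ((M.filter fun e => col e = j).card : ℝ) := by
    exact_mod_cast hPM j
  have h2 : p * ∑ i, w j i * activeCount a s (freed P) U i ≤
      ∑ e ∈ M, p * (2 * (m + 2 * B + 2).choose (k - 1) : ℕ) * w j (s (col e)) := by
    have hbij : Function.Bijective s := Finite.injective_iff_bijective.1 hs
    rw [sum_card_filter_eq_mul M col
        fun i => p * (2 * (m + 2 * B + 2).choose (k - 1) : ℕ) * w j (s i),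
      ← hbij.sum_comp fun i => w j i * (activeCount a s (freed P) U i : ℝ), Finset.mul_sum]
    refine Finset.sum_le_sum fun i _ => ?_
    have h3 : activeCount a s (freed P) U (s i) ≤
        (M.filter fun e => col e = i).card * (2 * (m + 2 * B + 2).choose (k - 1)) :=
      (activeCount_succ_le hs hm hP hUk hU (hcap i)).trans
        (by rw [mul_comm 2, mul_assoc]; exact Nat.mul_le_mul_right _ (hPM i))
    have h4 : (activeCount a s (freed P) U (s i) : ℝ) ≤
        ((M.filter fun e => col e = i).card : ℝ) *
          (2 * (m + 2 * B + 2).choose (k - 1) : ℕ) := by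
      exact_mod_cast h3
    have := mul_le_mul_of_nonneg_left h4 (mul_nonneg hp0 (hw0 j (s i)))
    linarith
  linarith

lemma expect_not_colorable_le [Nonempty V] {p W : ℝ} (hp0 : 0 ≤ p) (hp1 : p ≤ 1)
    (hs : Function.Injective s) (hs1 : ∀ j, s j ≠ j) (hs2 : ∀ j, s (s j) ≠ j) (hk : 3 ≤ k)
    (hm : ∀ j, ((Finset.univ : Finset V).filter fun v => a v = j).card ≤ m)
    (hpB : p * k * (4 * ((4 * B).choose (k - 2) * (m + 2 * B)) : ℕ) ≤ 3 / 4)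
    {w : C → C → ℝ} (hw0 : ∀ j i, 0 ≤ w j i)
    (hw : ∀ j i, Real.exp ((if i = j then 1 else 0) +
      p * (2 * (m + 2 * B + 2).choose (k - 1) : ℕ) * w j (s i)) - 1 ≤ w j i)
    (hW : ∀ j, ∑ i, w j i ≤ W) :
    expect p ((Finset.univ : Finset V).powersetCard k)
      (fun E => ind (¬ ∃ c : V → C, ∀ e ∈ E, ¬ Monochromatic c e)) ≤
      Fintype.card C * (∑ σ ∈ Finset.range (m + 1),
        (m.choose σ * (σ.choose k).choose (σ / 2 + 1) : ℕ) * p ^ (σ / 2 + 1)) +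
      112 * Fintype.card V * (4 * p * (Fintype.card V).choose (k - 2)) ^ 2 +
      Fintype.card C * Real.exp (-B + p * (W * m.choose k)) := by
  set ε : ℝ := 112 * Fintype.card V * (4 * p * (Fintype.card V).choose (k - 2)) ^ 2 with hε
  have hε0 : 0 ≤ ε := by positivity
  set A := (Finset.univ : Finset V).powersetCard k with hA
  set Q := A.filter fun e => Monochromatic a e with hQ
  set U := A.filter fun e => ¬ Monochromatic a e with hU
  have hAk : ∀ e ∈ A, e.card = k := fun e he => (Finset.mem_powersetCard.1 he).2
  have hQk : ∀ e ∈ Q, e.card = k := fun e he => hAk e (Finset.mem_filter.1 he).1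
  have hUk : ∀ e ∈ U, e.card = k := fun e he => hAk e (Finset.mem_filter.1 he).1
  have hUm : ∀ e ∈ U, ¬ Monochromatic a e := fun e he => (Finset.mem_filter.1 he).2
  have hdisj : Disjoint Q U := Finset.disjoint_filter_filter_not _ _ _
  have hunion : Q ∪ U = A := Finset.filter_union_filter_not_eq _ _
  obtain ⟨col, hcol⟩ : ∃ col : Finset V → C, ∀ e ∈ Q, ∀ v ∈ e, a v = col e := by
    refine ⟨fun e => if h : e.Nonempty then a h.choose else a (Classical.arbitrary V),
      fun e he v hv => ?_⟩
    have h : e.Nonempty := ⟨v, hv⟩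
    simp only [dif_pos h]
    exact (Finset.mem_filter.1 he).2 v hv _ h.choose_spec
  set Ψ : C → Finset (Finset V) → ℝ := fun j M => Real.exp (-B + ∑ e ∈ M,
    ((if col e = j then 1 else 0) +
      p * (2 * (m + 2 * B + 2).choose (k - 1) : ℕ) * w j (s (col e)))) with hΨ
  have hinner : ∀ M ⊆ Q, expect p U (fun E =>
      ind (¬ ∃ c : V → C, ∀ e ∈ M ∪ E, ¬ Monochromatic c e)) ≤
      ind (¬ TwoSdr M) + (ε + ∑ j, Ψ j M) := by
    intro M hMQ
    have hΨ0 : 0 ≤ ∑ j, Ψ j M := Finset.sum_nonneg fun j _ => (Real.exp_pos _).le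
    have hle1 := expect_indicator_le_one hp0 hp1 U
      fun E => ¬ ∃ c : V → C, ∀ e ∈ M ∪ E, ¬ Monochromatic c e
    by_cases hM : TwoSdr M
    swap
    · rw [ind_of_true hM]
      linarith
    rw [ind_of_false (not_not.2 hM), zero_add]
    obtain ⟨P, hP, hPM, hPc⟩ := hM.exists_validPairs fun e he => hcol e (hMQ he)
    by_cases hcap : ∀ j, pairCount a P j ≤ B
    · refine (expect_mono hp0 hp1 (g := fun E => ind (¬ SepColorable C P E))
        fun E _ => ind_mono (mt ?_)).trans
        ((expect_process_le hp0 hp1 hε0 hs hm hw0 hw ?_ _ P U rfl hP hUk hUm).trans ?_)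
      · rintro ⟨c, h1, h2⟩
        refine ⟨c, fun e he => ?_⟩
        rcases Finset.mem_union.1 he with he | he
        · obtain ⟨o, ho, ho1, ho2⟩ := hPM e he
          exact fun h => h1 o ho (h _ ho1 _ ho2)
        · exact h2 e he
      · intro P' hP' hcap' U' hU'k hU' hpoor
        exact expect_not_sepColorable_le hp0 hp1 hs hs1 hs2 hk hm hP' hcap' hpB hU'k hU' hpoor
      · exact add_le_add le_rfl (Finset.sum_le_sum fun j _ =>
          exp_pairs_le_exp_mono_edges hp0 hs hm hw0 hP hcap hUk hUm hPc j)
    · push Not at hcap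
      obtain ⟨j, hj⟩ := hcap
      have h1 : (B : ℝ) ≤ ((M.filter fun e => col e = j).card : ℝ) := by
        exact_mod_cast hj.le.trans (hPc j)
      have h2 : 1 ≤ Ψ j M := by
        refine Real.one_le_exp ?_
        rw [Finset.sum_add_distrib, Finset.sum_boole]
        have : 0 ≤ ∑ e ∈ M, p * (2 * (m + 2 * B + 2).choose (k - 1) : ℕ) * w j (s (col e)) :=
          Finset.sum_nonneg fun e _ => mul_nonneg (by positivity) (hw0 _ _)
        linarith
      have h3 := Finset.single_le_sum (f := fun j => Ψ j M)
        (fun j _ => (Real.exp_pos _).le) (Finset.mem_univ j)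
      linarith
  rw [← hunion, expect_union hdisj]
  refine (expect_mono hp0 hp1 hinner).trans ?_
  rw [expect_add, expect_add, expect_const, expect_sum]
  have hΨle : ∑ j, expect p Q (fun M => Ψ j M) ≤
      Fintype.card C * Real.exp (-B + p * (W * m.choose k)) := by
    rw [← Finset.card_univ, ← nsmul_eq_mul]
    refine Finset.sum_le_card_nsmul _ _ _ fun j _ => ?_
    exact expect_exp_mono_edges_le hp0 hp1 hm hQk hcol (u := fun i => (if i = j then 1 else 0) +
      p * (2 * (m + 2 * B + 2).choose (k - 1) : ℕ) * w j (s i)) (hw0 j) (hw j) (hW j) B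
  have := expect_not_twoSdr_le hp0 hp1 hm hQk hcol
  linarith

end Combine

section Cyclic

lemma val_cyclic_sub_succ {t : ℕ} {i j : Fin (t + 3)} (h : i ≠ j) :
    (j - i).val = (j - (i + 1)).val + 1 := by
  have h1 : j - i ≠ 0 := sub_ne_zero.2 h.symm
  have h2 : j - (i + 1) = (j - i) - 1 := by abel
  have h3 : (j - i).val ≠ 0 := fun h => h1 (Fin.ext h)
  rw [h2, Fin.val_sub_one_of_ne_zero h1]
  omega

lemma two_le_val_cyclic_sub_self_succ {t : ℕ} (j : Fin (t + 3)) : 2 ≤ (j - (j + 1)).val := by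
  have h2 : j - (j + 1) = -1 := by abel
  rw [h2, Fin.coe_neg_one]
  omega

lemma exp_le_inv_one_sub {x : ℝ} (hx : x < 1) : Real.exp x ≤ (1 - x)⁻¹ := by
  rw [← inv_inv (Real.exp x), ← Real.exp_neg]
  have := Real.add_one_le_exp (-x)
  exact inv_anti₀ (by linarith) (by linarith)

lemma exp_one_add_le_three {y : ℝ} (hy : y ≤ 0.092) : Real.exp (1 + y) ≤ 3 := by
  have h1 : Real.exp y ≤ (1 - 0.092)⁻¹ :=
    (Real.exp_le_exp.2 hy).trans (exp_le_inv_one_sub (by norm_num))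
  have h2 := Real.exp_one_lt_d9
  rw [Real.exp_add]
  have h3 : Real.exp 1 * Real.exp y ≤ 2.7182818286 * (1 - 0.092)⁻¹ :=
    mul_le_mul h2.le h1 (Real.exp_pos _).le (by norm_num)
  refine h3.trans (by norm_num)

lemma cyclic_weight_le {t : ℕ} {D : ℝ} (hD : D ≤ 0.184) (j i : Fin (t + 3)) :
    Real.exp ((if i = j then 1 else 0) + D * (2 * (1 / 2 : ℝ) ^ (j - (i + 1)).val)) - 1 ≤
      2 * (1 / 2 : ℝ) ^ (j - i).val := by
  by_cases h : i = j
  · subst h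
    rw [if_pos rfl, sub_self, Fin.val_zero, pow_zero]
    have h1 : (1 / 2 : ℝ) ^ (i - (i + 1)).val ≤ (1 / 2) ^ 2 :=
      pow_le_pow_of_le_one (by norm_num) (by norm_num) (two_le_val_cyclic_sub_self_succ i)
    have h2 : D * (2 * (1 / 2 : ℝ) ^ (i - (i + 1)).val) ≤ 0.184 * (2 * (1 / 2) ^ 2) :=
      mul_le_mul hD (by linarith) (by positivity) (by norm_num)
    have := exp_one_add_le_three (h2.trans (by norm_num))
    linarith
  · rw [if_neg h, zero_add, val_cyclic_sub_succ h]
    set z : ℝ := (1 / 2 : ℝ) ^ (j - (i + 1)).val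
    have hz0 : 0 ≤ z := by positivity
    have hz1 : z ≤ 1 := pow_le_one₀ (by norm_num) (by norm_num)
    have h1 : D * (2 * z) ≤ 0.368 * z := by nlinarith
    have h2 : Real.exp (D * (2 * z)) ≤ (1 - 0.368 * z)⁻¹ :=
      (Real.exp_le_exp.2 h1).trans (exp_le_inv_one_sub (by linarith))
    have h3 : (1 - 0.368 * z)⁻¹ ≤ 1 + z := by
      rw [inv_le_iff_one_le_mul₀ (by linarith)]
      nlinarith
    have h4 : (1 / 2 : ℝ) ^ ((j - (i + 1)).val + 1) = z / 2 := by rw [pow_succ]; ring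
    rw [h4]
    linarith

lemma sum_cyclic_weight_le {t : ℕ} (j : Fin (t + 3)) :
    ∑ i : Fin (t + 3), 2 * (1 / 2 : ℝ) ^ (j - i).val ≤ 4 := by
  have h := (Equiv.subLeft j).sum_comp fun x : Fin (t + 3) => 2 * (1 / 2 : ℝ) ^ x.val
  simp only [Equiv.subLeft_apply] at h
  rw [h, ← Finset.mul_sum, Fin.sum_univ_eq_sum_range fun x => (1 / 2 : ℝ) ^ x]
  have := sum_geometric_two_le (t + 3)
  linarith

lemma card_residue_class_le (n t : ℕ) (j : Fin (t + 3)) :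
    ((Finset.univ : Finset (Fin n)).filter fun v => Fin.ofNat (t + 3) v.val = j).card ≤
      n / (t + 3) + 1 := by
  rw [← Finset.card_range (n / (t + 3) + 1)]
  refine Finset.card_le_card_of_injOn (fun v => v.val / (t + 3)) (fun v _ => ?_)
    fun v hv w hw h => ?_
  · have : v.val / (t + 3) ≤ n / (t + 3) := Nat.div_le_div_right v.2.le
    simpa using Nat.lt_succ_of_le this
  · have h1 : v.val % (t + 3) = j := congrArg Fin.val (Finset.mem_filter.1 hv).2
    have h2 : w.val % (t + 3) = j := congrArg Fin.val (Finset.mem_filter.1 hw).2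
    have h3 : v.val / (t + 3) = w.val / (t + 3) := h
    apply Fin.ext
    rw [← Nat.div_add_mod v.val (t + 3), ← Nat.div_add_mod w.val (t + 3), h1, h2, h3]

lemma expect_not_rColorable_le {n r k m B : ℕ} {p : ℝ} (hn : 0 < n) (hr : 3 ≤ r)
    (hp0 : 0 ≤ p) (hp1 : p ≤ 1) (hk : 3 ≤ k) (hm : n / r + 1 ≤ m)
    (hpB : p * k * (4 * ((4 * B).choose (k - 2) * (m + 2 * B)) : ℕ) ≤ 3 / 4)
    (hD : p * (2 * (m + 2 * B + 2).choose (k - 1) : ℕ) ≤ 0.184) :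
    expect p ((Finset.univ : Finset (Fin n)).powersetCard k) (fun E => ind (¬ RColorable r E)) ≤
      r * (∑ σ ∈ Finset.range (m + 1),
        (m.choose σ * (σ.choose k).choose (σ / 2 + 1) : ℕ) * p ^ (σ / 2 + 1)) +
      112 * n * (4 * p * n.choose (k - 2)) ^ 2 +
      r * Real.exp (-B + p * (4 * m.choose k)) := by
  obtain ⟨t, rfl⟩ := Nat.exists_eq_add_of_le' hr
  have : Nonempty (Fin n) := ⟨⟨0, hn⟩⟩
  have h2 : ∀ j : Fin (t + 3), j - (j + 1) ≠ 0 := fun j h => by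
    have := two_le_val_cyclic_sub_self_succ j
    rw [h] at this
    simp at this
  have hs1 : ∀ j : Fin (t + 3), j + 1 ≠ j := fun j h => h2 j (by rw [h, sub_self])
  have := expect_not_colorable_le (V := Fin n) (C := Fin (t + 3)) (k := k) (m := m) (B := B)
    (a := fun v => Fin.ofNat (t + 3) v.val) (s := fun j => j + 1) (W := 4) hp0 hp1
    (fun i j h => add_right_cancel h) hs1 (fun j h => ?_) hk
    (fun j => ?_) hpB
    (w := fun j i => 2 * (1 / 2 : ℝ) ^ (j - i).val) (fun j i => by positivity)
    (fun j i => by convert cyclic_weight_le hD j i) sum_cyclic_weight_le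
  · simpa [RColorable] using this
  · have h3 := two_le_val_cyclic_sub_self_succ j
    have h4 := val_cyclic_sub_succ (i := j + 1) (j := j) (hs1 j)
    rw [h] at h4
    simp at h4
  · refine le_trans (le_of_eq ?_) ((card_residue_class_le n t j).trans hm)
    congr

end Cyclic

section Numerics

lemma choose_mul_pow_le {a n : ℕ} (h : a ≤ n) (k : ℕ) :
    a.choose k * n ^ k ≤ n.choose k * a ^ k := by
  induction k with
  | zero => simp
  | succ k ih =>
    have h1 : (a - k) * n ≤ (n - k) * a := by
      rw [Nat.sub_mul, Nat.sub_mul, mul_comm a n]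
      exact Nat.sub_le_sub_left (Nat.mul_le_mul_left k h) _
    have h2 : (k + 1) * (a.choose (k + 1) * n ^ (k + 1)) ≤
        (k + 1) * (n.choose (k + 1) * a ^ (k + 1)) := by
      calc (k + 1) * (a.choose (k + 1) * n ^ (k + 1))
          = (a.choose (k + 1) * (k + 1)) * n ^ (k + 1) := by ring
        _ = (a.choose k * n ^ k) * ((a - k) * n) := by rw [Nat.choose_succ_right_eq]; ring
        _ ≤ (n.choose k * a ^ k) * ((n - k) * a) := Nat.mul_le_mul ih h1
        _ = (n.choose (k + 1) * (k + 1)) * a ^ (k + 1) := by rw [Nat.choose_succ_right_eq]; ring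
        _ = _ := by ring
    exact Nat.le_of_mul_le_mul_left h2 (Nat.succ_pos k)

lemma choose_le_mul_div_pow {a n : ℕ} (h : a ≤ n) (hn : 0 < n) (k : ℕ) :
    (a.choose k : ℝ) ≤ n.choose k * ((a : ℝ) / n) ^ k := by
  have hn' : (0 : ℝ) < n := by exact_mod_cast hn
  rw [div_pow, ← mul_div_assoc, le_div_iff₀ (by positivity)]
  exact_mod_cast choose_mul_pow_le h k

lemma choose_le_exp_mul_div_pow (L t : ℕ) (ht : 0 < t) :
    (L.choose t : ℝ) ≤ (Real.exp 1 * L / t) ^ t := by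
  have ht' : (0 : ℝ) < t := by exact_mod_cast ht
  have h1 : (L.choose t : ℝ) ≤ (L : ℝ) ^ t / t.factorial := Nat.choose_le_pow_div t L
  have h2 : (t : ℝ) ^ t / t.factorial ≤ Real.exp t := Real.pow_div_factorial_le_exp _ ht'.le t
  have h3 : (Real.exp 1 * L / t) ^ t = Real.exp t * ((L : ℝ) ^ t / (t : ℝ) ^ t) := by
    rw [mul_div_assoc, mul_pow, div_pow, ← Real.exp_nat_mul, mul_one]
  rw [h3]
  refine h1.trans ?_
  have hf : (0 : ℝ) < t.factorial := by exact_mod_cast t.factorial_pos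
  have h4 := mul_le_mul_of_nonneg_right h2 (show 0 ≤ (L : ℝ) ^ t / (t : ℝ) ^ t by positivity)
  refine le_trans (le_of_eq ?_) h4
  field_simp

lemma sq_le_three_pow {k : ℕ} (hk : 3 ≤ k) : k ^ 2 ≤ 3 ^ (k - 1) := by
  induction k, hk using Nat.le_induction with
  | base => norm_num
  | succ k hk ih =>
    obtain ⟨l, rfl⟩ := Nat.exists_eq_add_of_le hk
    have h1 : 3 + l + 1 - 1 = (3 + l - 1) + 1 := by omega
    rw [h1, pow_succ 3]
    nlinarith

/-- The edge count `k r^(k-1)` is small compared with `n`. -/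
structure SmallParams (n k r : ℕ) (X : ℝ) : Prop where
  hk : 3 ≤ k
  hr : 3 ≤ r
  hX : (k : ℝ) * (r : ℝ) ^ (k - 1) = X
  hXn : X ^ 4 ≤ n

namespace SmallParams

variable {n k r : ℕ} {X : ℝ}

lemma three_le_k (h : SmallParams n k r X) : (3 : ℝ) ≤ k := by exact_mod_cast h.hk

lemma three_le_r (h : SmallParams n k r X) : (3 : ℝ) ≤ r := by exact_mod_cast h.hr

lemma k_cube_le (h : SmallParams n k r X) : (k : ℝ) ^ 3 ≤ X := by
  have h1 : (k : ℝ) ^ 2 ≤ (r : ℝ) ^ (k - 1) := by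
    have h2 : (k : ℝ) ^ 2 ≤ 3 ^ (k - 1) := by exact_mod_cast sq_le_three_pow h.hk
    exact h2.trans (pow_le_pow_left₀ (by norm_num) h.three_le_r _)
  have := mul_le_mul_of_nonneg_left h1 (Nat.cast_nonneg k)
  rw [h.hX] at this
  linarith [show (k : ℝ) ^ 3 = k * k ^ 2 by ring]

lemma k_mul_r_sq_le (h : SmallParams n k r X) : (k : ℝ) * r ^ 2 ≤ X := by
  rw [← h.hX]
  refine mul_le_mul_of_nonneg_left (pow_le_pow_right₀ ?_ ?_) (Nat.cast_nonneg k)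
  · linarith [h.three_le_r]
  · have := h.hk
    omega

lemma le_X (h : SmallParams n k r X) : (27 : ℝ) ≤ X := by
  have h1 := pow_le_pow_left₀ (by norm_num) h.three_le_k 3
  linarith [h.k_cube_le]

lemma X_sq_le (h : SmallParams n k r X) : X ^ 2 ≤ Real.sqrt n := by
  refine Real.le_sqrt_of_sq_le ?_
  linarith [h.hXn, show (X ^ 2) ^ 2 = X ^ 4 by ring]

lemma mul_X_le (h : SmallParams n k r X) : 19683 * X ≤ n := by
  have h1 := pow_le_pow_left₀ (by norm_num) h.le_X 3
  have h2 := mul_le_mul_of_nonneg_right h1 (show 0 ≤ X by linarith [h.le_X])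
  linarith [h.hXn, show X ^ 4 = X ^ 3 * X by ring]

lemma mul_X_sq_le (h : SmallParams n k r X) : 729 * X ^ 2 ≤ n := by
  have h1 := pow_le_pow_left₀ (by norm_num) h.le_X 2
  have h2 := mul_le_mul_of_nonneg_right h1 (sq_nonneg X)
  linarith [h.hXn, show X ^ 4 = X ^ 2 * X ^ 2 by ring]

lemma k_mul_r_le (h : SmallParams n k r X) : (k : ℝ) * r ≤ X := by
  have h1 := h.k_mul_r_sq_le
  have h2 := h.three_le_r
  have h3 : (k : ℝ) * r ≤ k * r ^ 2 := by
    refine mul_le_mul_of_nonneg_left ?_ (Nat.cast_nonneg k)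
    nlinarith
  linarith

lemma k_sq_mul_r_le (h : SmallParams n k r X) : (k : ℝ) ^ 2 * r ≤ X ^ 2 := by
  have h1 := h.k_mul_r_le
  have h2 := h.k_cube_le
  have h3 := h.three_le_k
  have h4 := h.three_le_r
  have h5 : (k : ℝ) ≤ X := by nlinarith
  have h6 : (0 : ℝ) ≤ k * r := by positivity
  nlinarith

lemma k_le_X (h : SmallParams n k r X) : (k : ℝ) ≤ X := by
  have h1 := h.k_mul_r_le
  have h3 := h.three_le_k
  have h4 := h.three_le_r
  nlinarith

lemma r_le_X (h : SmallParams n k r X) : (r : ℝ) ≤ X := by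
  have h1 := h.k_mul_r_le
  have h3 := h.three_le_k
  have h4 := h.three_le_r
  nlinarith

lemma n_pos (h : SmallParams n k r X) : (0 : ℝ) < n := by linarith [h.mul_X_le, h.le_X]

lemma sqrt_k_ge (h : SmallParams n k r X) : 1.73 ≤ Real.sqrt k := by
  refine Real.le_sqrt_of_sq_le ?_
  linarith [h.three_le_k, show (1.73 : ℝ) ^ 2 ≤ 3 by norm_num]

variable {p A : ℝ}

lemma mul_choose_le (h : SmallParams n k r X) (hp0 : 0 ≤ p)
    (hp : p * n.choose k ≤ A * ((r : ℝ) ^ (k - 1) * n))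
    {a : ℕ} (ha : a ≤ n) :
    p * a.choose k ≤ A * ((n : ℝ) / r) * (a / ((n : ℝ) / r)) ^ k := by
  have hn := h.n_pos
  have hr := h.three_le_r
  have h1 := mul_le_mul_of_nonneg_left
    (choose_le_mul_div_pow ha (by exact_mod_cast hn) k) hp0
  have h2 := mul_le_mul_of_nonneg_right hp (show 0 ≤ ((a : ℝ) / n) ^ k by positivity)
  have h3 : A * ((n : ℝ) / r) * (a / ((n : ℝ) / r)) ^ k =
      A * ((r : ℝ) ^ (k - 1) * n) * ((a : ℝ) / n) ^ k := by
    have h4 : (a / ((n : ℝ) / r)) ^ k = (r : ℝ) * r ^ (k - 1) * ((a : ℝ) / n) ^ k := by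
      rw [mul_pow_sub_one (by have := h.hk; omega), ← mul_pow]
      congr 1
      field_simp
    rw [h4]
    field_simp
  rw [h3]
  linarith

lemma mul_choose_pred_le (h : SmallParams n k r X) (hp0 : 0 ≤ p)
    (hp : p * n.choose k ≤ A * ((r : ℝ) ^ (k - 1) * n)) {a : ℕ} (ha : a ≤ n - 1) :
    p * a.choose (k - 1) ≤ A * k * (r * a / ((n : ℝ) - 1)) ^ (k - 1) := by
  have hn := h.n_pos
  have hn2 : (27 : ℝ) ≤ n := by linarith [h.mul_X_le, h.le_X]
  have hn3 : 27 ≤ n := by exact_mod_cast hn2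
  have hkn : n * (n - 1).choose (k - 1) = n.choose k * k := by
    have := Nat.add_one_mul_choose_eq (n - 1) (k - 1)
    have hk := h.hk
    rwa [Nat.sub_add_cancel (by omega), Nat.sub_add_cancel (by omega)] at this
  have hkn' : (n : ℝ) * (n - 1).choose (k - 1) = n.choose k * k := by exact_mod_cast hkn
  have h1 : p * (n - 1).choose (k - 1) ≤ A * k * (r : ℝ) ^ (k - 1) := by
    refine le_of_mul_le_mul_left ?_ hn
    have := mul_le_mul_of_nonneg_right hp (Nat.cast_nonneg k)
    calc (n : ℝ) * (p * (n - 1).choose (k - 1)) = p * (n * (n - 1).choose (k - 1)) := by ring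
      _ = p * n.choose k * k := by rw [hkn']; ring
      _ ≤ _ := this
      _ = _ := by ring
  have h2 := mul_le_mul_of_nonneg_left (choose_le_mul_div_pow ha (by omega) (k - 1)) hp0
  have hcast : ((n - 1 : ℕ) : ℝ) = (n : ℝ) - 1 := by
    rw [Nat.cast_sub (by omega), Nat.cast_one]
  rw [hcast] at h2
  have h3 := mul_le_mul_of_nonneg_right h1
    (show 0 ≤ ((a : ℝ) / ((n : ℝ) - 1)) ^ (k - 1) from
      pow_nonneg (div_nonneg (Nat.cast_nonneg a) (by linarith)) _)
  have h4 : A * k * (r * a / ((n : ℝ) - 1)) ^ (k - 1) =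
      A * k * (r : ℝ) ^ (k - 1) * ((a : ℝ) / ((n : ℝ) - 1)) ^ (k - 1) := by
    rw [mul_div_assoc, mul_pow]
    ring
  rw [h4]
  linarith

lemma mul_choose_pred_pred_le (h : SmallParams n k r X) (hp0 : 0 ≤ p)
    (hp : p * n.choose k ≤ A * ((r : ℝ) ^ (k - 1) * n)) :
    p * n.choose (k - 2) ≤ 1.2 * (A * (r : ℝ) ^ (k - 1) * (k * (k - 1)) / n) := by
  have hn := h.n_pos
  have hk := h.hk
  have hk3 := h.three_le_k
  have hkX := h.k_le_X
  have hXn := h.mul_X_le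
  have hkn : k ≤ n := by
    have : (k : ℝ) ≤ n := by linarith
    exact_mod_cast this
  have e1 := Nat.choose_succ_right_eq n (k - 2)
  have e2 := Nat.choose_succ_right_eq n (k - 1)
  rw [show k - 2 + 1 = k - 1 by omega] at e1
  rw [show k - 1 + 1 = k by omega] at e2
  have e1' : (n.choose (k - 1) : ℝ) * (k - 1) = n.choose (k - 2) * (n - k + 2) := by
    have := congrArg (Nat.cast (R := ℝ)) e1
    push_cast [Nat.cast_sub (show 1 ≤ k by omega), Nat.cast_sub (show k - 2 ≤ n by omega),
      Nat.cast_sub (show 2 ≤ k by omega)] at this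
    linarith
  have e2' : (n.choose k : ℝ) * k = n.choose (k - 1) * (n - k + 1) := by
    have := congrArg (Nat.cast (R := ℝ)) e2
    push_cast [Nat.cast_sub (show 1 ≤ k by omega), Nat.cast_sub (show k - 1 ≤ n by omega)] at this
    linarith
  have h1 : p * n.choose (k - 2) * ((n - k + 2) * (n - k + 1)) ≤
      A * (r : ℝ) ^ (k - 1) * (k * (k - 1)) * n := by
    have h2 := mul_le_mul_of_nonneg_right hp (show (0 : ℝ) ≤ k * (k - 1) by nlinarith)
    calc p * n.choose (k - 2) * ((n - k + 2) * (n - k + 1))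
        = p * (n.choose (k - 2) * (n - k + 2)) * (n - k + 1) := by ring
      _ = p * (n.choose (k - 1) * (n - k + 1)) * (k - 1) := by rw [← e1']; ring
      _ = p * n.choose k * (k * (k - 1)) := by rw [← e2']; ring
      _ ≤ _ := h2
      _ = _ := by ring
  have h3 : (n : ℝ) ^ 2 ≤ 1.2 * ((n - k + 2) * (n - k + 1)) := by nlinarith
  rw [← mul_div_assoc, le_div_iff₀ hn]
  refine le_of_mul_le_mul_right ?_ hn
  have h4 := mul_le_mul_of_nonneg_left h3
    (show 0 ≤ p * n.choose (k - 2) from mul_nonneg hp0 (Nat.cast_nonneg _))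
  nlinarith

end SmallParams

end Numerics

section Estimates

lemma cast_class_size_le (n r : ℕ) : ((n / r + 1 : ℕ) : ℝ) ≤ (n : ℝ) / r + 1 := by
  push_cast
  have := Nat.cast_div_le (α := ℝ) (m := n) (n := r)
  linarith

lemma cast_cap_le (n k r : ℕ) : ((n / (4 * k * r) : ℕ) : ℝ) ≤ (n : ℝ) / r / (4 * k) := by
  have := Nat.cast_div_le (α := ℝ) (m := n) (n := 4 * k * r)
  push_cast at this
  rwa [div_div, mul_comm (r : ℝ)]

lemma le_cast_cap (n k r : ℕ) : (n : ℝ) / r / (4 * k) - 1 ≤ ((n / (4 * k * r) : ℕ) : ℝ) := by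
  have h1 := Nat.lt_floor_add_one ((n : ℝ) / ((4 * k * r : ℕ) : ℝ))
  rw [Nat.floor_div_eq_div] at h1
  push_cast at h1
  rw [div_div, mul_comm (r : ℝ)]
  linarith

namespace SmallParams

variable {n k r : ℕ} {X : ℝ}

lemma div_r_pos (h : SmallParams n k r X) :
    0 < (n : ℝ) / r := div_pos h.n_pos (by linarith [h.three_le_r])

lemma r_div_n_le (h : SmallParams n k r X) : (r : ℝ) / n ≤ 1 / 19683 := by
  rw [div_le_div_iff₀ h.n_pos (by norm_num)]
  linarith [h.r_le_X, h.mul_X_le]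

lemma class_ratio_le (h : SmallParams n k r X) {a : ℕ} (ha : a ≤ n / r + 1) :
    (a : ℝ) / ((n : ℝ) / r) ≤ 1 + r / n := by
  have h1 : (a : ℝ) ≤ (n : ℝ) / r + 1 := le_trans (by exact_mod_cast ha) (cast_class_size_le n r)
  have h2 := h.div_r_pos
  have h3 : (r : ℝ) / n * ((n : ℝ) / r) = 1 := by
    have := h.n_pos
    have := h.three_le_r
    field_simp
  rw [div_le_iff₀ h2]
  linarith

lemma one_add_pow_le (h : SmallParams n k r X) {l : ℕ} (hl : l ≤ k) :
    (1 + (r : ℝ) / n) ^ l ≤ 1.01 := by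
  have h0 : 0 ≤ (r : ℝ) / n := by positivity
  have hn := h.n_pos
  have h1 : (1 + (r : ℝ) / n) ^ l ≤ (1 + (r : ℝ) / n) ^ k :=
    pow_le_pow_right₀ (by linarith) hl
  have h2 : (1 + (r : ℝ) / n) ^ k ≤ Real.exp ((r : ℝ) / n) ^ k := by
    refine pow_le_pow_left₀ (by linarith) ?_ k
    linarith [Real.add_one_le_exp ((r : ℝ) / n)]
  rw [← Real.exp_nat_mul] at h2
  have h3 : (k : ℝ) * (r / n) ≤ 1 / 19683 := by
    rw [← mul_div_assoc, div_le_div_iff₀ hn (by norm_num)]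
    linarith [h.k_mul_r_le, h.mul_X_le]
  have h4 := exp_le_inv_one_sub (x := 1 / 19683) (by norm_num)
  have h5 := Real.exp_le_exp.2 h3
  have h6 : (1 - 1 / 19683 : ℝ)⁻¹ ≤ 1.01 := by norm_num
  linarith

lemma class_size_le_n (h : SmallParams n k r X) : n / r + 1 ≤ n := by
  have h1 := h.hr
  have h2 : (27 : ℝ) ≤ n := by linarith [h.mul_X_le, h.le_X]
  have h3 : 27 ≤ n := by exact_mod_cast h2
  have h4 : n / r ≤ n / 3 := Nat.div_le_div_left h1 (by norm_num)
  omega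

lemma k_mul_pred_le (h : SmallParams n k r X) : (k : ℝ) * (k - 1) ≤ 2 * (k : ℝ) ^ (k - 2) := by
  have hk := h.three_le_k
  rcases h.hk.eq_or_lt with h3 | h3
  · subst h3
    norm_num
  · have : (k : ℝ) ^ 2 ≤ (k : ℝ) ^ (k - 2) := pow_le_pow_right₀ (by linarith) (by omega)
    nlinarith

variable {p A : ℝ}

lemma density_pos (h : SmallParams n k r X) (hA : A * (k * Real.sqrt k) = 3 / 32) :
    0 < A := by
  have h1 := h.sqrt_k_ge
  have h2 := h.three_le_k
  have h3 : 0 < k * Real.sqrt k := by positivity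
  by_contra hc
  nlinarith

lemma density_mul_k_le (h : SmallParams n k r X) (hA : A * (k * Real.sqrt k) = 3 / 32) :
    A * k ≤ 0.0542 := by
  have h1 := h.sqrt_k_ge
  have h2 := h.three_le_k
  have h3 : 0 ≤ A * k := mul_nonneg (h.density_pos hA).le (by linarith)
  nlinarith

lemma density_le (h : SmallParams n k r X) (hA : A * (k * Real.sqrt k) = 3 / 32) :
    A ≤ 0.01807 := by
  have h1 := h.density_mul_k_le hA
  have h2 := h.three_le_k
  have h3 := (h.density_pos hA).le
  nlinarith

lemma mul_choose_pred_pred_le_X (h : SmallParams n k r X) (hA : A * (k * Real.sqrt k) = 3 / 32)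
    (hp0 : 0 ≤ p)
    (hp : p * n.choose k ≤ A * ((r : ℝ) ^ (k - 1) * n)) :
    p * n.choose (k - 2) ≤ X / n := by
  have hn := h.n_pos
  have h1 := h.mul_choose_pred_pred_le hp0 hp
  refine h1.trans ?_
  rw [← mul_div_assoc]
  refine div_le_div_of_nonneg_right ?_ hn.le
  have h2 := h.density_mul_k_le hA
  have h3 := h.le_X
  have h4 := h.three_le_k
  have h5 := (h.density_pos hA).le
  have h6 : 1.2 * (A * (r : ℝ) ^ (k - 1) * (k * (k - 1))) = 1.2 * (A * (k - 1)) * X := by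
    rw [← h.hX]
    ring
  rw [h6]
  nlinarith

lemma prob_le_one (h : SmallParams n k r X) (hA : A * (k * Real.sqrt k) = 3 / 32)
    (hp0 : 0 ≤ p)
    (hp : p * n.choose k ≤ A * ((r : ℝ) ^ (k - 1) * n)) :
    p ≤ 1 := by
  have h1 := h.mul_choose_pred_pred_le_X hA hp0 hp
  have hn := h.n_pos
  have h2 : X / n ≤ 1 := by
    rw [div_le_one hn]
    linarith [h.mul_X_le, h.le_X]
  have h3 : k - 2 ≤ n := by
    have : (k : ℝ) ≤ n := by linarith [h.mul_X_le, h.le_X, h.k_le_X]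
    have : k ≤ n := by exact_mod_cast this
    omega
  have h4 : (1 : ℝ) ≤ n.choose (k - 2) := by exact_mod_cast Nat.choose_pos h3
  nlinarith

lemma closed_family_density_le (h : SmallParams n k r X) (hA : A * (k * Real.sqrt k) = 3 / 32)
    (hp0 : 0 ≤ p)
    (hp : p * n.choose k ≤ A * ((r : ℝ) ^ (k - 1) * n))
    :
    p * k * (4 * ((4 * (n / (4 * k * r))).choose (k - 2) *
      ((n / r + 1) + 2 * (n / (4 * k * r)))) : ℕ) ≤ 3 / 4 := by
  set B := n / (4 * k * r) with hB
  have hn := h.n_pos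
  have hk := h.three_le_k
  have hr := h.three_le_r
  have hA0 := (h.density_pos hA).le
  have hNp := h.div_r_pos
  have hBle := cast_cap_le n k r
  rw [← hB] at hBle
  have hratio : ((4 * B : ℕ) : ℝ) / n ≤ 1 / (k * r) := by
    push_cast
    rw [div_le_div_iff₀ hn (by positivity), one_mul]
    rw [div_div, le_div_iff₀ (by positivity)] at hBle
    linarith
  have hfour : 4 * B ≤ n := by
    have : ((4 * B : ℕ) : ℝ) / n ≤ 1 := hratio.trans (by
      rw [div_le_one (by positivity)]
      nlinarith)
    rw [div_le_one hn] at this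
    exact_mod_cast this
  have h1 : p * (4 * B).choose (k - 2) ≤ 2.4 * A * (r / n) := by
    have e1 := mul_le_mul_of_nonneg_left
      (choose_le_mul_div_pow hfour (by exact_mod_cast hn) (k - 2)) hp0
    have e2 : (((4 * B : ℕ) : ℝ) / n) ^ (k - 2) ≤ (1 / (k * r)) ^ (k - 2) :=
      pow_le_pow_left₀ (by positivity) hratio _
    have e3 := h.mul_choose_pred_pred_le hp0 hp
    have e4 : p * n.choose (k - 2) * (((4 * B : ℕ) : ℝ) / n) ^ (k - 2) ≤
        1.2 * (A * (r : ℝ) ^ (k - 1) * (k * (k - 1)) / n) * (1 / (k * r)) ^ (k - 2) := by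
      refine mul_le_mul e3 e2 (by positivity) ?_
      have : (0 : ℝ) ≤ k - 1 := by linarith
      positivity
    have e5 : 1.2 * (A * (r : ℝ) ^ (k - 1) * (k * (k - 1)) / n) * (1 / (k * r)) ^ (k - 2) =
        1.2 * A * (r / n) * (k * (k - 1) / (k : ℝ) ^ (k - 2)) := by
      have : (r : ℝ) ^ (k - 1) = r * r ^ (k - 2) := by
        rw [← pow_succ']
        congr 1
        have := h.hk
        omega
      rw [this, one_div, inv_pow, mul_pow]
      field_simp
    have e6 : k * (k - 1) / (k : ℝ) ^ (k - 2) ≤ 2 := by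
      rw [div_le_iff₀ (by positivity)]
      exact h.k_mul_pred_le
    have e7 := mul_le_mul_of_nonneg_left e6 (show 0 ≤ 1.2 * A * (r / n) by positivity)
    linarith
  have h2 : ((n / r + 1 : ℕ) : ℝ) + 2 * B ≤ 1.2 * (n / r) := by
    have e1 := cast_class_size_le n r
    have e2 : (n : ℝ) / r / (4 * k) ≤ (n : ℝ) / r / 12 := by
      refine div_le_div_of_nonneg_left hNp.le (by norm_num) (by linarith)
    have e3 : (1 : ℝ) ≤ 1 / 100 * (n / r) := by
      rw [← mul_div_assoc, le_div_iff₀ (by linarith)]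
      linarith [h.r_le_X, h.mul_X_le]
    linarith
  have h3 : p * (4 * B).choose (k - 2) * (((n / r + 1 : ℕ) : ℝ) + 2 * B) ≤ 2.88 * A := by
    have := mul_le_mul h1 h2 (by positivity) (by positivity)
    refine this.trans (le_of_eq ?_)
    field_simp
    ring
  have h4 := mul_le_mul_of_nonneg_left h3 (show (0 : ℝ) ≤ 4 * k by positivity)
  have h5 := h.density_mul_k_le hA
  push_cast at h4 ⊢
  linarith

lemma activity_le (h : SmallParams n k r X) (hA : A * (k * Real.sqrt k) = 3 / 32)
    (hp0 : 0 ≤ p)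
    (hp : p * n.choose k ≤ A * ((r : ℝ) ^ (k - 1) * n))
    :
    p * (2 * ((n / r + 1) + 2 * (n / (4 * k * r)) + 2).choose (k - 1) : ℕ) ≤ 0.184 := by
  set a := (n / r + 1) + 2 * (n / (4 * k * r)) + 2 with ha
  have hn := h.n_pos
  have hk := h.three_le_k
  have hr := h.three_le_r
  have hA0 := (h.density_pos hA).le
  have hXn := h.mul_X_le
  have hX27 := h.le_X
  have hk1 : ((k - 1 : ℕ) : ℝ) = k - 1 := by
    rw [Nat.cast_sub (by have := h.hk; omega), Nat.cast_one]
  have h1 : (r : ℝ) * a ≤ (n - 1) * (1 + 1 / (2 * (k - 1))) := by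
    have e1 := cast_class_size_le n r
    have e2 := cast_cap_le n k r
    have e3 : (a : ℝ) ≤ n / r + 3 + 2 * (n / r / (4 * k)) := by
      rw [ha]
      push_cast at e1 e2 ⊢
      linarith
    have e4 := mul_le_mul_of_nonneg_left e3 (show (0 : ℝ) ≤ r by linarith)
    have e5 : (r : ℝ) * (n / r + 3 + 2 * (n / r / (4 * k))) = n + 3 * r + n / (2 * k) := by
      field_simp
      ring
    rw [e5] at e4
    refine e4.trans ?_
    have hk' : (0 : ℝ) < k - 1 := by linarith
    have e6 : (n : ℝ) / (2 * k) + 3 * r + 1 + 1 / (2 * (k - 1)) ≤ n / (2 * (k - 1)) := by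
      have e7 : 1 / (2 * ((k : ℝ) - 1)) ≤ 1 := by
        rw [div_le_one (by linarith)]
        linarith
      have e8 : (n : ℝ) / (2 * (k - 1)) - n / (2 * k) = n / (2 * k * (k - 1)) := by
        field_simp
        ring
      have e9 : 3 * (r : ℝ) + 2 ≤ n / (2 * k * (k - 1)) := by
        rw [le_div_iff₀ (by positivity)]
        have f1 := h.k_sq_mul_r_le
        have f2 := h.mul_X_sq_le
        have f3 : (3 * (r : ℝ) + 2) * (2 * k * (k - 1)) ≤ (4 * r) * (2 * k ^ 2) := by
          refine mul_le_mul (by linarith) (by nlinarith) (by positivity) (by linarith)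
        nlinarith
      linarith
    have e10 : ((n : ℝ) - 1) * (1 + 1 / (2 * (k - 1))) =
        n - 1 + n / (2 * (k - 1)) - 1 / (2 * (k - 1)) := by ring
    rw [e10]
    linarith
  have hn1 : (0 : ℝ) < n - 1 := by linarith
  have h2 : (r : ℝ) * a / (n - 1) ≤ 1 + 1 / (2 * (k - 1)) := by
    rw [div_le_iff₀ hn1, mul_comm _ ((n : ℝ) - 1)]
    exact h1
  have han : a ≤ n - 1 := by
    have e1 : 1 / (2 * ((k : ℝ) - 1)) ≤ 1 := by
      rw [div_le_one (by linarith)]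
      linarith
    have e2 : (a : ℝ) ≤ n - 1 := by nlinarith
    have e3 : ((a + 1 : ℕ) : ℝ) ≤ n := by
      push_cast
      linarith
    have e4 : a + 1 ≤ n := by exact_mod_cast e3
    omega
  have h3 := h.mul_choose_pred_le hp0 hp han
  have h4 : (r * a / ((n : ℝ) - 1)) ^ (k - 1) ≤ 1.6488 := by
    have e1 : (r * a / ((n : ℝ) - 1)) ^ (k - 1) ≤ Real.exp (1 / (2 * (k - 1))) ^ (k - 1) := by
      refine pow_le_pow_left₀ (by positivity) ?_ _
      linarith [Real.add_one_le_exp (1 / (2 * ((k : ℝ) - 1)))]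
    rw [← Real.exp_nat_mul, hk1] at e1
    have e2 : ((k : ℝ) - 1) * (1 / (2 * (k - 1))) = 1 / 2 := by
      have : (k : ℝ) - 1 ≠ 0 := by linarith
      field_simp
    rw [e2] at e1
    refine e1.trans ?_
    have e3 : Real.exp (1 / 2) ^ 2 = Real.exp 1 := by
      rw [← Real.exp_nat_mul]
      norm_num
    have e4 := Real.exp_one_lt_d9
    refine (sq_le_sq₀ (Real.exp_pos _).le (by norm_num)).1 ?_
    rw [e3]
    norm_num
    linarith
  have h5 := h.density_mul_k_le hA
  have h6 : A * k * (r * a / ((n : ℝ) - 1)) ^ (k - 1) ≤ 0.0542 * 1.6488 :=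
    mul_le_mul h5 h4 (by positivity) (by norm_num)
  push_cast
  linarith

lemma overflow_le (h : SmallParams n k r X) (hA : A * (k * Real.sqrt k) = 3 / 32)
    (hp0 : 0 ≤ p)
    (hp : p * n.choose k ≤ A * ((r : ℝ) ^ (k - 1) * n))
    :
    r * Real.exp (-((n / (4 * k * r) : ℕ) : ℝ) + p * (4 * (n / r + 1).choose k)) ≤
      100 * (X / n) := by
  have hn := h.n_pos
  have hk := h.three_le_k
  have hr := h.three_le_r
  have hA0 := (h.density_pos hA).le
  set N : ℝ := (n : ℝ) / r with hN
  have hN0 : 0 < N := h.div_r_pos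
  have h1 := h.mul_choose_le hp0 hp h.class_size_le_n
  have h2 : (((n / r + 1 : ℕ) : ℝ) / N) ^ k ≤ 1.01 :=
    (pow_le_pow_left₀ (by positivity) (h.class_ratio_le le_rfl) k).trans (h.one_add_pow_le le_rfl)
  have h3 : p * (n / r + 1).choose k ≤ 0.05475 * (N / k) := by
    refine h1.trans ((mul_le_mul_of_nonneg_left h2 (by positivity)).trans ?_)
    have h4 : A ≤ 0.0542 / k := by
      rw [le_div_iff₀ (by linarith)]
      exact h.density_mul_k_le hA
    have h5 := mul_le_mul_of_nonneg_right h4 hN0.le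
    have h6 : 0.0542 / k * N = 0.0542 * (N / k) := by ring
    have h7 : 0 ≤ N / k := by positivity
    linarith
  have h4 := le_cast_cap n k r
  have h5 : N / (4 * k) = 0.25 * (N / k) := by
    field_simp
    norm_num
  rw [← hN, h5] at h4
  set y : ℝ := N / k with hy
  have hy0 : 0 < y := by positivity
  have h6 : Real.exp (-((n / (4 * k * r) : ℕ) : ℝ) + p * (4 * (n / r + 1).choose k)) ≤
      Real.exp 1 * Real.exp (-(0.03 * y)) := by
    rw [← Real.exp_add, Real.exp_le_exp]
    linarith
  have h7 : Real.exp (-(0.03 * y)) ≤ (0.03 * y)⁻¹ := by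
    rw [Real.exp_neg]
    refine inv_anti₀ (by positivity) ?_
    linarith [Real.add_one_le_exp (0.03 * y)]
  have h8 : Real.exp 1 * Real.exp (-(0.03 * y)) ≤ 2.7182818286 * (0.03 * y)⁻¹ :=
    mul_le_mul Real.exp_one_lt_d9.le h7 (Real.exp_pos _).le (by norm_num)
  have h9 : (r : ℝ) * y⁻¹ ≤ X / n := by
    have : (r : ℝ) * y⁻¹ = (k * r ^ 2) / n := by
      rw [hy, hN]
      field_simp
    rw [this]
    exact div_le_div_of_nonneg_right h.k_mul_r_sq_le hn.le
  have h10 := mul_le_mul_of_nonneg_left (h6.trans h8) (show (0 : ℝ) ≤ r by linarith)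
  rw [mul_inv] at h10
  have h11 : 0 ≤ (r : ℝ) * y⁻¹ := by positivity
  norm_num at h10 ⊢
  linarith

end SmallParams

end Estimates

section Conclusion

lemma sum_mul_pow_le (l : ℕ) : ∑ σ ∈ Finset.range l, (σ : ℝ) * 0.9 ^ σ ≤ 90 := by
  have h := hasSum_coe_mul_geometric_of_norm_lt_one (𝕜 := ℝ) (r := 0.9) (by norm_num)
  have h2 := sum_le_hasSum (Finset.range l) (fun σ _ => by positivity) h
  refine h2.trans (by norm_num)

namespace SmallParams

variable {n k r : ℕ} {X : ℝ}

variable {p A : ℝ}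

lemma dense_term_le (h : SmallParams n k r X) (hA : A * (k * Real.sqrt k) = 3 / 32)
    (hp0 : 0 ≤ p)
    (hp : p * n.choose k ≤ A * ((r : ℝ) ^ (k - 1) * n))
    {σ : ℕ} (hσ : σ ≤ n / r + 1) :
    ((n / r + 1).choose σ * (σ.choose k).choose (σ / 2 + 1) : ℕ) * p ^ (σ / 2 + 1) ≤
      (σ : ℝ) * 0.9 ^ σ / ((n : ℝ) / r) := by
  set N : ℝ := (n : ℝ) / r with hN
  set m := n / r + 1 with hm
  set t := σ / 2 + 1 with ht
  have hN0 : 0 < N := h.div_r_pos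
  have hA0 := (h.density_pos hA).le
  rcases lt_or_ge σ k with hσk | hσk
  · rw [Nat.choose_eq_zero_of_lt hσk, Nat.choose_eq_zero_of_lt (Nat.succ_pos _)]
    simp only [mul_zero, Nat.cast_zero, zero_mul]
    positivity
  have hk := h.hk
  have hσ0 : (0 : ℝ) < σ := by
    have : 0 < σ := by omega
    exact_mod_cast this
  have he := Real.exp_one_lt_d9
  have he0 := Real.exp_pos 1
  have hrn := h.r_div_n_le
  have hrn0 : 0 ≤ (r : ℝ) / n := by positivity
  set y : ℝ := σ / N with hy
  have hy0 : 0 < y := by positivity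
  have hyN : y * N = σ := by
    rw [hy]
    field_simp
  have hyq : y ≤ 1 + r / n := h.class_ratio_le hσ
  have hmq : m / N ≤ 1 + r / n := h.class_ratio_le le_rfl
  have ht0 : 0 < t := Nat.succ_pos _
  have ht2 : σ + 1 ≤ 2 * t := by omega
  have ht1 : (σ : ℝ) / 2 ≤ t := by
    have : ((σ + 1 : ℕ) : ℝ) ≤ ((2 * t : ℕ) : ℝ) := by exact_mod_cast ht2
    push_cast at this
    linarith
  have h1 := h.mul_choose_le hp0 hp (hσ.trans h.class_size_le_n)
  have h2 : y ^ k ≤ 1.01 * y ^ 2 * y := by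
    have e1 : y ^ k = y ^ (k - 3) * (y ^ 2 * y) := by
      rw [← pow_succ, ← pow_add]
      congr 1
      omega
    have e2 : y ^ (k - 3) ≤ 1.01 := (pow_le_pow_left₀ hy0.le hyq _).trans
      (h.one_add_pow_le (by omega))
    rw [e1, mul_assoc]
    exact mul_le_mul_of_nonneg_right e2 (by positivity)
  have hY : Real.exp 1 * (p * σ.choose k) / t ≤ (0.315 * y) ^ 2 := by
    have e1 : p * σ.choose k ≤ A * 1.01 * y ^ 2 * σ := by
      refine h1.trans ((mul_le_mul_of_nonneg_left h2 (by positivity)).trans (le_of_eq ?_))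
      rw [← hyN]
      ring
    have e2 : A * 1.01 * y ^ 2 * σ ≤ A * 1.01 * y ^ 2 * (2 * t) :=
      mul_le_mul_of_nonneg_left (by linarith) (by positivity)
    have ht0' : (0 : ℝ) < t := by exact_mod_cast ht0
    rw [div_le_iff₀ ht0']
    have e3 := mul_le_mul_of_nonneg_left (e1.trans e2) he0.le
    have e4 : Real.exp 1 * A ≤ 2.7182818286 * 0.01807 :=
      mul_le_mul he.le (h.density_le hA) hA0 (by norm_num)
    have e5 := mul_le_mul_of_nonneg_right e4 (show 0 ≤ y ^ 2 * t by positivity)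
    have e6 : 0 ≤ y ^ 2 * t := by positivity
    linarith
  have hz1 : 0.315 * y ≤ 1 := by linarith
  have h3 : ((σ.choose k).choose t : ℝ) * p ^ t ≤ (0.315 * y) ^ (σ + 1) := by
    have e1 := mul_le_mul_of_nonneg_right (choose_le_exp_mul_div_pow (σ.choose k) t ht0)
      (pow_nonneg hp0 t)
    rw [← mul_pow] at e1
    have e2 : Real.exp 1 * (σ.choose k : ℝ) / t * p = Real.exp 1 * (p * σ.choose k) / t := by ring
    rw [e2] at e1
    refine e1.trans ((pow_le_pow_left₀ (by positivity) hY t).trans ?_)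
    rw [← pow_mul]
    exact pow_le_pow_of_le_one (by positivity) hz1 ht2
  have h4 : (m.choose σ : ℝ) * (0.315 * y) ^ σ ≤ 0.9 ^ σ := by
    have e1 := mul_le_mul_of_nonneg_right (choose_le_exp_mul_div_pow m σ (by omega))
      (show 0 ≤ (0.315 * y) ^ σ by positivity)
    rw [← mul_pow] at e1
    refine e1.trans (pow_le_pow_left₀ (by positivity) ?_ σ)
    have e2 : Real.exp 1 * m / σ * (0.315 * y) = Real.exp 1 * (m / N) * 0.315 := by
      rw [hy]
      field_simp
    rw [e2]
    have e3 : Real.exp 1 * (m / N) ≤ 2.7182818286 * (1 + 1 / 19683) :=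
      mul_le_mul he.le (by linarith) (by positivity) (by norm_num)
    refine (mul_le_mul_of_nonneg_right e3 (by norm_num)).trans (by norm_num)
  have h5 : (σ : ℝ) * 0.9 ^ σ / N = y * 0.9 ^ σ := by
    rw [hy]
    ring
  rw [h5]
  push_cast
  have h6 := mul_le_mul_of_nonneg_left h3 (Nat.cast_nonneg (α := ℝ) (m.choose σ))
  have h7 := mul_le_mul_of_nonneg_right h4 (show 0 ≤ 0.315 * y by positivity)
  have h8 : 0 ≤ y * (0.9 : ℝ) ^ σ := by positivity
  rw [pow_succ (0.315 * y)] at h6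
  linarith

lemma dense_sum_le (h : SmallParams n k r X) (hA : A * (k * Real.sqrt k) = 3 / 32)
    (hp0 : 0 ≤ p)
    (hp : p * n.choose k ≤ A * ((r : ℝ) ^ (k - 1) * n))
    :
    r * ∑ σ ∈ Finset.range (n / r + 1 + 1),
      (((n / r + 1).choose σ * (σ.choose k).choose (σ / 2 + 1) : ℕ) : ℝ) * p ^ (σ / 2 + 1) ≤
      90 * (X / n) := by
  have hn := h.n_pos
  have hk := h.three_le_k
  have hr := h.three_le_r
  have h1 : ∑ σ ∈ Finset.range (n / r + 1 + 1),
      (((n / r + 1).choose σ * (σ.choose k).choose (σ / 2 + 1) : ℕ) : ℝ) * p ^ (σ / 2 + 1) ≤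
      90 / ((n : ℝ) / r) := by
    refine (Finset.sum_le_sum fun σ hσ => h.dense_term_le hA hp0 hp
      (Nat.lt_succ_iff.1 (Finset.mem_range.1 hσ))).trans ?_
    rw [← Finset.sum_div]
    exact div_le_div_of_nonneg_right (sum_mul_pow_le _) h.div_r_pos.le
  refine (mul_le_mul_of_nonneg_left h1 (Nat.cast_nonneg r)).trans ?_
  have h2 : (r : ℝ) * (90 / ((n : ℝ) / r)) = 90 * (r ^ 2 / n) := by
    field_simp
  rw [h2]
  refine mul_le_mul_of_nonneg_left (div_le_div_of_nonneg_right ?_ hn.le) (by norm_num)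
  have := h.k_mul_r_sq_le
  nlinarith [sq_nonneg (r : ℝ)]

lemma expect_not_rColorable_le_sqrt (h : SmallParams n k r X) (hA : A * (k * Real.sqrt k) = 3 / 32)
    (hp0 : 0 ≤ p)
    (hp : p * n.choose k ≤ A * ((r : ℝ) ^ (k - 1) * n))
    :
    expect p ((Finset.univ : Finset (Fin n)).powersetCard k) (fun E => ind (¬ RColorable r E)) ≤
      2000 / Real.sqrt n := by
  have hn := h.n_pos
  have h1 := expect_not_rColorable_le (n := n) (r := r) (k := k) (m := n / r + 1)
    (B := n / (4 * k * r)) (by exact_mod_cast hn) h.hr hp0 (h.prob_le_one hA hp0 hp) h.hk le_rfl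
    (h.closed_family_density_le hA hp0 hp) (h.activity_le hA hp0 hp)
  have h2 := h.dense_sum_le hA hp0 hp
  have h3 := h.overflow_le hA hp0 hp
  have h4 : 112 * (n : ℝ) * (4 * p * n.choose (k - 2)) ^ 2 ≤ 1792 * (X ^ 2 / n) := by
    have e1 := h.mul_choose_pred_pred_le_X hA hp0 hp
    have e2 : (p * n.choose (k - 2)) ^ 2 ≤ (X / n) ^ 2 := pow_le_pow_left₀ (by positivity) e1 2
    calc 112 * (n : ℝ) * (4 * p * n.choose (k - 2)) ^ 2
        = 1792 * n * (p * n.choose (k - 2)) ^ 2 := by ring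
      _ ≤ 1792 * n * (X / n) ^ 2 := mul_le_mul_of_nonneg_left e2 (by positivity)
      _ = 1792 * (X ^ 2 / n) := by
        field_simp
  have h5 : X / n ≤ X ^ 2 / n := by
    refine div_le_div_of_nonneg_right ?_ hn.le
    nlinarith [h.le_X]
  have h6 : X ^ 2 / n ≤ 1 / Real.sqrt n := by
    rw [div_le_div_iff₀ hn (Real.sqrt_pos.2 hn), one_mul]
    have := mul_le_mul_of_nonneg_right h.X_sq_le (Real.sqrt_nonneg n)
    rwa [Real.mul_self_sqrt hn.le] at this
  have h7 : 2000 / Real.sqrt n = 2000 * (1 / Real.sqrt n) := by ring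
  have h8 : 0 ≤ X ^ 2 / n := by positivity
  rw [h7]
  linarith

end SmallParams

lemma hyperProb_eq (n k : ℕ) (p : ℝ) (P : Finset (Finset (Fin n)) → Prop) :
    hyperProb n k p P =
      1 - expect p ((Finset.univ : Finset (Fin n)).powersetCard k) (fun E => ind (¬ P E)) := by
  have h1 : hyperProb n k p P =
      expect p ((Finset.univ : Finset (Fin n)).powersetCard k) (fun E => ind (P E)) := by
    unfold hyperProb expect ind
    refine Finset.sum_congr rfl fun E _ => ?_
    by_cases h : P E <;> simp [h]
  have h2 : expect p ((Finset.univ : Finset (Fin n)).powersetCard k) (fun E => ind (P E)) +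
      expect p ((Finset.univ : Finset (Fin n)).powersetCard k) (fun E => ind (¬ P E)) = 1 := by
    rw [← expect_add, ← expect_const (p := p) ((Finset.univ : Finset (Fin n)).powersetCard k) 1]
    refine expect_congr fun E _ => ?_
    by_cases h : P E
    · rw [ind_of_true h, ind_of_false (not_not.2 h), add_zero]
    · rw [ind_of_false h, ind_of_true h, zero_add]
  linarith

lemma eventually_smallParams {k r : ℕ → ℕ} (hk : ∀ n, 3 ≤ k n) (hr : ∀ n, 3 ≤ r n)
    (hd : Tendsto
      (fun n => (3 / 128 : ℝ) * (r n : ℝ) ^ (k n - 1) / Real.sqrt (k n) -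
        Real.log n) atTop atBot) :
    ∀ᶠ n : ℕ in atTop, SmallParams n (k n) (r n) (k n * (r n : ℝ) ^ (k n - 1)) := by
  have hlog : ∀ᶠ n : ℕ in atTop, (128 / 3 * Real.log n) ^ 8 ≤ (n : ℝ) := by
    have h1 := (Real.isLittleO_pow_log_id_atTop (n := 8)).bound
      (show (0 : ℝ) < ((128 / 3) ^ 8)⁻¹ by positivity)
    filter_upwards [tendsto_natCast_atTop_atTop.eventually h1] with n hn
    rw [id, Real.norm_of_nonneg (by positivity), Real.norm_of_nonneg (by positivity),
      inv_mul_eq_div, le_div_iff₀ (by positivity)] at hn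
    rw [mul_pow]
    linarith
  filter_upwards [hlog, hd.eventually_le_atBot 0] with n hn h0
  refine ⟨hk n, hr n, rfl, le_trans ?_ hn⟩
  set R : ℝ := (r n : ℝ) ^ (k n - 1) with hR
  set s := Real.sqrt (k n) with hs
  set L := 128 / 3 * Real.log n with hL
  have hk3 : (3 : ℝ) ≤ k n := by exact_mod_cast hk n
  have hr3 : (3 : ℝ) ≤ r n := by exact_mod_cast hr n
  have hs0 : 0 < s := Real.sqrt_pos.2 (by linarith)
  have hss : s * s = k n := Real.mul_self_sqrt (by linarith)
  have hRs : R ≤ L * s := by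
    have h1 : 3 / 128 * R / s ≤ Real.log n := by linarith
    rw [div_le_iff₀ hs0] at h1
    rw [hL]
    linarith
  have hkR : (k n : ℝ) ^ 2 ≤ R := by
    have h2 : (k n : ℝ) ^ 2 ≤ 3 ^ (k n - 1) := by exact_mod_cast sq_le_three_pow (hk n)
    exact h2.trans (pow_le_pow_left₀ (by norm_num) hr3 _)
  have hks : (k n : ℝ) * s ≤ L := by
    refine le_of_mul_le_mul_right ?_ hs0
    rw [mul_assoc, hss]
    linarith [sq (k n : ℝ)]
  have hL0 : 0 ≤ L := le_trans (by positivity) hks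
  have hX : (k n : ℝ) * R ≤ L ^ 2 := by
    have h1 := mul_le_mul_of_nonneg_left hRs (show (0 : ℝ) ≤ k n by linarith)
    have h2 := mul_le_mul_of_nonneg_right hks hL0
    linarith [sq L]
  calc ((k n : ℝ) * R) ^ 4 ≤ (L ^ 2) ^ 4 := pow_le_pow_left₀ (by positivity) hX 4
    _ = L ^ 8 := by ring

end Conclusion

end HG

/-- Suppose `k = k(n) ≥ 3` and `r = r(n) ≥ 3` satisfy
`(3/128) r^(k-1)/√k − ln n → −∞`. If `p = p(n) ≤ (3/32)(r^(k-1)/k^(3/2)) n / C(n,k)`,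
then `P(H(n,k,p) is r-colorable) → 1` as `n → ∞`. -/
theorem stmt3 (k r : ℕ → ℕ) (p : ℕ → ℝ)
    (hk : ∀ n, 3 ≤ k n) (hr : ∀ n, 3 ≤ r n)
    (hd : Tendsto
      (fun n => (3 / 128 : ℝ) * (r n : ℝ) ^ (k n - 1) / Real.sqrt (k n) -
        Real.log n) atTop atBot)
    (hp0 : ∀ n, 0 ≤ p n)
    (hp : ∀ n, p n ≤ (3 / 32 : ℝ) *
        ((r n : ℝ) ^ (k n - 1) / (k n : ℝ) ^ ((3 : ℝ) / 2)) *
        ((n : ℝ) / (n.choose (k n) : ℝ))) :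
    Tendsto (fun n => HG.hyperProb n (k n) (p n) (HG.RColorable (r n)))
      atTop (nhds 1) := by
  have hle : ∀ᶠ n : ℕ in atTop, 1 - 2000 / Real.sqrt n ≤
      HG.hyperProb n (k n) (p n) (HG.RColorable (r n)) ∧
      HG.hyperProb n (k n) (p n) (HG.RColorable (r n)) ≤ 1 := by
    filter_upwards [HG.eventually_smallParams hk hr hd] with n h
    have hk3 := h.three_le_k
    have hs := h.sqrt_k_ge
    have hA : (3 / 32 / (k n * Real.sqrt (k n))) * (k n * Real.sqrt (k n)) = (3 / 32 : ℝ) := by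
      have : (k n : ℝ) * Real.sqrt (k n) ≠ 0 := by positivity
      field_simp
    have hkn : k n ≤ n := by
      have : (k n : ℝ) ≤ n := by linarith [h.k_le_X, h.mul_X_le, h.le_X]
      exact_mod_cast this
    have hc : (0 : ℝ) < n.choose (k n) := by exact_mod_cast Nat.choose_pos hkn
    have hpow : (k n : ℝ) ^ ((3 : ℝ) / 2) = k n * Real.sqrt (k n) := by
      rw [Real.sqrt_eq_rpow, show (3 : ℝ) / 2 = 1 + 1 / 2 by norm_num,
        Real.rpow_add (by linarith), Real.rpow_one]
    have hpn : p n * n.choose (k n) ≤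
        3 / 32 / (k n * Real.sqrt (k n)) * ((r n : ℝ) ^ (k n - 1) * n) := by
      have h1 := hp n
      rw [hpow, ← mul_div_assoc, le_div_iff₀ hc] at h1
      refine h1.trans (le_of_eq ?_)
      ring
    have hmain := h.expect_not_rColorable_le_sqrt hA (hp0 n) hpn
    have hnonneg := HG.expect_mono (hp0 n) (h.prob_le_one hA (hp0 n) hpn)
      (Q := (Finset.univ : Finset (Fin n)).powersetCard (k n)) (f := fun _ => 0)
      (g := fun E => HG.ind (¬ HG.RColorable (r n) E)) fun E _ => HG.ind_nonneg _
    rw [HG.expect_const] at hnonneg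
    rw [HG.hyperProb_eq]
    exact ⟨by linarith, by linarith⟩
  have hlim : Tendsto (fun n : ℕ => 1 - 2000 / Real.sqrt n) atTop (nhds 1) := by
    have h1 : Tendsto (fun n : ℕ => 2000 / Real.sqrt n) atTop (nhds 0) :=
      tendsto_const_nhds.div_atTop (Real.tendsto_sqrt_atTop.comp tendsto_natCast_atTop_atTop)
    simpa using tendsto_const_nhds.sub h1
  exact tendsto_of_tendsto_of_tendsto_of_le_of_le' hlim tendsto_const_nhds
    (hle.mono fun n h => h.1) (hle.mono fun n h => h.2)
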